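/- arXiv:2011.05068 — 2 statements merged into one kernel-verified Lean document; each statement's English description precedes it below -/
import Mathlib

section
/- Consider a sequence of models indexed by n in which X_1,…,X_n are i.i.d. N(0, Σ_n) in ℝ^{d_n}, with universal constants λ_*, λ^* > 0 such that λ_* ≤ λ_1(Σ_n) ≤ ⋯ ≤ λ_{d_n}(Σ_n) ≤ λ^*, with ‖Σ_n − I‖_F = O(√(d_n/n)), d_n/n → τ ∈ (0,∞), and m_1/n → κ ∈ (0,1). Then the test φ_cov = 1{ T_cov > z_{1−α} } satisfies E_P[φ_cov] = Φ( z_α + n √(κ(1−κ)) ‖Σ_n − I‖_F² / ( √2 · tr(Σ_n²) ) ) + o(1) as n → ∞. In particular the asymptotic power is maximized when κ = 1/2. -/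
/-!
Statement 10: Asymptotic power expression for the cross covariance test (Theorem 7 of
Kim & Ramdas).  For i.i.d. `N(0, Σ_n)` samples in `ℝ^{d_n}` with eigenvalues bounded in
`[λ_*, λ^*]`, `‖Σ_n − I‖_F = O(√(d_n/n))`, `d_n/n → τ ∈ (0,∞)` and `m₁/n → κ ∈ (0,1)`,
the test `φ_cov = 1{T_cov > z_{1−α}}` satisfies
`E[φ_cov] = Φ(z_α + n√(κ(1−κ))‖Σ_n − I‖_F²/(√2·tr(Σ_n²))) + o(1)`; the factor
`√(κ(1−κ))` is maximized at `κ = 1/2`.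
-/

open MeasureTheory ProbabilityTheory Filter

noncomputable section

/-- Euclidean dot product on `Fin d → ℝ`. -/
def dot {d : ℕ} (x y : Fin d → ℝ) : ℝ := ∑ i, x i * y i

/-- Studentized statistic of a sample of reals. -/
def studentized (m : ℕ) (y : Fin m → ℝ) : ℝ :=
  Real.sqrt m * ((∑ i, y i) / m) /
    Real.sqrt ((∑ i, (y i - (∑ j, y j) / m) ^ 2) / m)

/-- Standard normal cumulative distribution function. -/
def Φ (z : ℝ) : ℝ := ∫ t in Set.Iic z, Real.exp (-t ^ 2 / 2) / Real.sqrt (2 * Real.pi)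

/-- The covariance kernel `tr{(xxᵀ − I)(yyᵀ − I)} = (xᵀy)² − xᵀx − yᵀy + d`. -/
def hCov (d : ℕ) (x y : Fin d → ℝ) : ℝ :=
  dot x y ^ 2 - dot x x - dot y y + d

/-- The studentized cross covariance statistic `T_cov`. -/
def Tcov (d m₁ m₂ : ℕ) (ω : Fin (m₁ + m₂) → Fin d → ℝ) : ℝ :=
  studentized m₁ fun i =>
    (∑ j : Fin m₂, hCov d (ω (Fin.castAdd m₂ i)) (ω (Fin.natAdd m₁ j))) / m₂

/-- Squared Frobenius norm of a matrix. -/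
def frobSq {d : ℕ} (A : Matrix (Fin d) (Fin d) ℝ) : ℝ := ∑ i, ∑ j, A i j ^ 2

/-- `P` is the multivariate Gaussian on `ℝ^d` with mean `μv` and covariance `S`. -/
def IsGaussianVec {d : ℕ} (P : Measure (Fin d → ℝ)) (μv : Fin d → ℝ)
    (S : Matrix (Fin d) (Fin d) ℝ) : Prop :=
  IsProbabilityMeasure P ∧ S.IsSymm ∧
  ∀ u : Fin d → ℝ,
    P.map (fun x => dot u x) = gaussianReal (dot u μv) (Real.toNNReal (dot u (S.mulVec u)))

section
/-! ### Facts about `Φ` -/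

lemma Phi_eq_real (z : ℝ) : Φ z = (gaussianReal 0 1).real (Set.Iic z) := by
  rw [Measure.real, gaussianReal_apply_eq_integral _ one_ne_zero, ENNReal.toReal_ofReal]
  · unfold Φ
    congr 1
    ext t
    simp [gaussianPDFReal]
    ring
  · exact integral_nonneg fun x => gaussianPDFReal_nonneg _ _ _

lemma Phi_mono : Monotone Φ := by
  intro a b hab
  rw [Phi_eq_real, Phi_eq_real]
  exact measureReal_mono (Set.Iic_subset_Iic.2 hab)

lemma Phi_real_Ioc {a b : ℝ} (hab : a ≤ b) :
    (gaussianReal 0 1).real (Set.Ioc a b) = Φ b - Φ a := by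
  rw [Phi_eq_real, Phi_eq_real, ← Set.Iic_sdiff_Iic, measureReal_sdiff (Set.Iic_subset_Iic.2 hab)
    measurableSet_Iic]

lemma Phi_sub_le {a b : ℝ} (hab : a ≤ b) : Φ b - Φ a ≤ b - a := by
  rw [← Phi_real_Ioc hab, Measure.real, gaussianReal_apply_eq_integral _ one_ne_zero,
    ENNReal.toReal_ofReal (integral_nonneg fun x => gaussianPDFReal_nonneg _ _ _)]
  have h1 : ∀ x, gaussianPDFReal 0 1 x ≤ 1 := by
    intro x
    simp only [gaussianPDFReal]
    have h2 : (√(2 * Real.pi * ((1 : NNReal) : ℝ)))⁻¹ ≤ 1 := by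
      apply inv_le_one_of_one_le₀
      rw [Real.one_le_sqrt]
      have := Real.pi_gt_three
      simp
      linarith
    have h3 : Real.exp (-(x - 0) ^ 2 / (2 * ((1 : NNReal) : ℝ))) ≤ 1 := by
      rw [Real.exp_le_one_iff]
      have := sq_nonneg x
      simp
      linarith
    calc _ ≤ (1 : ℝ) * 1 := mul_le_mul h2 h3 (Real.exp_pos _).le zero_le_one
      _ = 1 := one_mul 1
  calc ∫ x in Set.Ioc a b, gaussianPDFReal 0 1 x ≤ ∫ x in Set.Ioc a b, (1 : ℝ) :=
        setIntegral_mono_on (integrable_gaussianPDFReal _ _).integrableOn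
          (by simp) measurableSet_Ioc (fun x _ => h1 x)
    _ = b - a := by simp [hab]

lemma Phi_lip (a b : ℝ) : |Φ b - Φ a| ≤ |b - a| := by
  rcases le_total a b with h | h
  · rw [abs_of_nonneg (sub_nonneg.2 (Phi_mono h)), abs_of_nonneg (sub_nonneg.2 h)]
    exact Phi_sub_le h
  · rw [abs_sub_comm, abs_sub_comm b, abs_of_nonneg (sub_nonneg.2 (Phi_mono h)),
      abs_of_nonneg (sub_nonneg.2 h)]
    exact Phi_sub_le h

lemma Phi_continuous : Continuous Φ := by
  have : LipschitzWith 1 Φ := by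
    apply LipschitzWith.of_dist_le_mul
    intro x y
    simpa [Real.dist_eq] using Phi_lip y x
  exact this.continuous

lemma Phi_strictMono : StrictMono Φ := by
  intro a b hab
  have h := Phi_real_Ioc hab.le
  have h2 : 0 < (gaussianReal 0 1).real (Set.Ioc a b) := by
    rw [measureReal_def]
    apply ENNReal.toReal_pos _ (measure_ne_top _ _)
    intro h0
    have := gaussianReal_absolutelyContinuous' 0 (v := 1) one_ne_zero h0
    simp at this
    linarith
  linarith

lemma gaussian_Ioi (x : ℝ) : (gaussianReal 0 1).real (Set.Ioi x) = Φ (-x) := by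
  have h : (gaussianReal 0 1).map (fun x => -x) = gaussianReal 0 1 := by
    rw [gaussianReal_map_neg]; simp
  have h2 : (fun x : ℝ => -x) ⁻¹' (Set.Ioi x) = Set.Iio (-x) := by
    ext y; simp only [Set.mem_preimage, Set.mem_Ioi, Set.mem_Iio]
    constructor <;> intro h <;> linarith
  have : NullSingletonClass (gaussianReal 0 1) := nullSingletonClass_gaussianReal one_ne_zero
  have h3 : (gaussianReal 0 1).real (Set.Iio (-x)) = (gaussianReal 0 1).real (Set.Iic (-x)) :=
    measureReal_congr Iio_ae_eq_Iic
  rw [Phi_eq_real, ← h3]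
  conv_lhs => rw [← h]
  rw [map_measureReal_apply (by fun_prop) measurableSet_Ioi, h2]

lemma Phi_neg (x : ℝ) : Φ (-x) = 1 - Φ x := by
  rw [← gaussian_Ioi, Phi_eq_real, ← Set.compl_Iic, probReal_compl_eq_one_sub measurableSet_Iic]

lemma gaussian_shift_Ioi (x : ℝ) : (gaussianReal (-x) 1).real (Set.Ioi 0) = Φ (-x) := by
  have h := gaussianReal_map_add_const (μ := 0) (v := 1) (-x)
  rw [zero_add] at h
  rw [← h, map_measureReal_apply (by fun_prop) measurableSet_Ioi, ← gaussian_Ioi]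
  congr 1
  ext y
  simp

/-! ### A uniform central limit theorem -/

/-- Centered, unit variance, fourth moment at most `K`. -/
structure StdMom (K : ℝ) (ν : Measure ℝ) : Prop where
  int4 : Integrable (fun x : ℝ => x ^ 4) ν
  mean : ∫ x, x ∂ν = 0
  var : ∫ x, x ^ 2 ∂ν = 1
  m4 : ∫ x, x ^ 4 ∂ν ≤ K

lemma integrable_pow_of_four {ν : Measure ℝ} [IsProbabilityMeasure ν]
    (h : Integrable (fun x : ℝ => x ^ 4) ν) (k : ℕ) (hk : k ≤ 4) :
    Integrable (fun x : ℝ => |x| ^ k) ν := by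
  refine Integrable.mono' ((integrable_const (1 : ℝ)).add h) (by fun_prop) (ae_of_all _ fun x => ?_)
  simp only [Real.norm_eq_abs, abs_pow, abs_abs, Pi.add_apply]
  have e : x ^ 4 = |x| ^ 4 := (Even.pow_abs (by decide) x).symm
  rw [e]
  rcases le_total |x| 1 with h1 | h1
  · have := pow_le_one₀ (n := k) (abs_nonneg x) h1
    have : 0 ≤ |x| ^ 4 := by positivity
    linarith
  · have := pow_le_pow_right₀ h1 hk
    linarith

lemma exp_taylor_three (x : ℝ) :
    ‖Complex.exp (x * Complex.I) - (1 + x * Complex.I - x ^ 2 / 2)‖ ≤ 4 * |x| ^ 3 := by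
  have hn : ‖(x : ℂ) * Complex.I‖ = |x| := by simp
  rcases le_total |x| 1 with h1 | h1
  · have h := Complex.norm_exp_sub_sum_le_norm_mul_exp (x * Complex.I) 3
    rw [hn] at h
    have e : ∑ m ∈ Finset.range 3, ((x : ℂ) * Complex.I) ^ m / (m.factorial : ℂ)
        = (1 + x * Complex.I - x ^ 2 / 2) := by
      simp [Finset.sum_range_succ, Nat.factorial, mul_pow]
      ring
    rw [e] at h
    refine h.trans ?_
    have h3 : Real.exp |x| ≤ 4 := by
      have := Real.exp_one_lt_d9
      have := Real.exp_le_exp.2 h1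
      linarith
    have : 0 ≤ |x| ^ 3 := by positivity
    nlinarith
  · have a1 : ‖Complex.exp (x * Complex.I)‖ = 1 := Complex.norm_exp_ofReal_mul_I x
    have a2 : ‖(1 + x * Complex.I - x ^ 2 / 2 : ℂ)‖ ≤ 1 + |x| + |x| ^ 2 / 2 := by
      refine (norm_sub_le _ _).trans ?_
      refine add_le_add ((norm_add_le _ _).trans ?_) ?_
      · simp
      · simp
    refine (norm_sub_le _ _).trans ?_
    rw [a1]
    have b1 : 1 ≤ |x| ^ 3 := one_le_pow₀ h1
    have b2 : |x| ≤ |x| ^ 3 := le_self_pow₀ h1 (by norm_num)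
    have b3 : |x| ^ 2 ≤ |x| ^ 3 := pow_le_pow_right₀ h1 (by norm_num)
    linarith

lemma charFun_taylor {K : ℝ} {ν : Measure ℝ} [IsProbabilityMeasure ν] (h : StdMom K ν) (s : ℝ) :
    ‖charFun ν s - (1 - (s : ℂ) ^ 2 / 2)‖ ≤ 4 * (1 + K) * |s| ^ 3 := by
  have i1 : Integrable (fun x : ℝ => x) ν := by
    have := integrable_pow_of_four h.int4 1 (by norm_num)
    simpa using (integrable_norm_iff (by fun_prop)).1 (by simpa using this)
  have i2 : Integrable (fun x : ℝ => x ^ 2) ν := by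
    simpa using integrable_pow_of_four h.int4 2 (by norm_num)
  have i3 := integrable_pow_of_four h.int4 3 (by norm_num)
  have ie : Integrable (fun x : ℝ => Complex.exp (s * x * Complex.I)) ν := by
    refine Integrable.mono' (integrable_const (1 : ℝ)) (by fun_prop) (ae_of_all _ fun x => ?_)
    have := Complex.norm_exp_ofReal_mul_I (s * x)
    push_cast at this
    rw [this]
  have i1c : Integrable (fun x : ℝ => (x : ℂ)) ν := i1.ofReal
  have i2c : Integrable (fun x : ℝ => ((x ^ 2 : ℝ) : ℂ)) ν := i2.ofReal
  have e1 : (1 - (s : ℂ) ^ 2 / 2) =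
      ∫ x : ℝ, (1 + (s * Complex.I) * (x : ℂ) - (s : ℂ) ^ 2 / 2 * ((x ^ 2 : ℝ) : ℂ)) ∂ν := by
    rw [integral_sub, integral_add, integral_const_mul, integral_const_mul, integral_complex_ofReal,
      integral_complex_ofReal, h.mean, h.var]
    · simp
    · exact integrable_const _
    · exact i1c.const_mul _
    · exact (integrable_const _).add (i1c.const_mul _)
    · exact i2c.const_mul _
  have i5 : Integrable (fun x : ℝ => 1 + (s * Complex.I) * (x : ℂ) -
      (s : ℂ) ^ 2 / 2 * ((x ^ 2 : ℝ) : ℂ)) ν :=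
    ((integrable_const _).add (i1c.const_mul _)).sub (i2c.const_mul _)
  rw [charFun_apply_real, e1, ← integral_sub ie i5]
  have b : ∀ x : ℝ, ‖Complex.exp (s * x * Complex.I) -
      (1 + (s * Complex.I) * (x : ℂ) - (s : ℂ) ^ 2 / 2 * ((x ^ 2 : ℝ) : ℂ))‖ ≤
      4 * |s| ^ 3 * |x| ^ 3 := by
    intro x
    have := exp_taylor_three (s * x)
    push_cast at this ⊢
    rw [abs_mul, mul_pow] at this
    calc _ = _ := by congr 2; ring
      _ ≤ _ := this
      _ = _ := by ring
  refine (norm_integral_le_of_norm_le (i3.const_mul (4 * |s| ^ 3)) (ae_of_all _ b)).trans ?_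
  rw [integral_const_mul]
  have h3 : ∫ x, |x| ^ 3 ∂ν ≤ 1 + K := by
    calc ∫ x, |x| ^ 3 ∂ν ≤ ∫ x, (1 + x ^ 4) ∂ν := by
          refine integral_mono i3 ((integrable_const _).add h.int4) fun x => ?_
          have e : x ^ 4 = |x| ^ 4 := (Even.pow_abs (by decide) x).symm
          simp only [e]
          rcases le_total |x| 1 with h1 | h1
          · have := pow_le_one₀ (n := 3) (abs_nonneg x) h1
            have : 0 ≤ |x| ^ 4 := by positivity
            linarith
          · have := pow_le_pow_right₀ h1 (show 3 ≤ 4 by norm_num)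
            linarith
      _ = 1 + ∫ x, x ^ 4 ∂ν := by
          rw [integral_add (integrable_const _) h.int4]; simp
      _ ≤ 1 + K := by linarith [h.m4]
  calc 4 * |s| ^ 3 * ∫ x, |x| ^ 3 ∂ν ≤ 4 * |s| ^ 3 * (1 + K) :=
        mul_le_mul_of_nonneg_left h3 (by positivity)
    _ = _ := by ring

lemma norm_pow_sub_pow_le' {a b : ℂ} (ha : ‖a‖ ≤ 1) (hb : ‖b‖ ≤ 1) (m : ℕ) :
    ‖a ^ m - b ^ m‖ ≤ m * ‖a - b‖ := by
  induction m with
  | zero => simp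
  | succ k ih =>
    have e : a ^ (k + 1) - b ^ (k + 1) = a ^ k * (a - b) + (a ^ k - b ^ k) * b := by ring
    rw [e]
    refine (norm_add_le _ _).trans ?_
    rw [norm_mul, norm_mul, norm_pow]
    have h1 : ‖a‖ ^ k ≤ 1 := pow_le_one₀ (norm_nonneg _) ha
    have h2 : ‖a‖ ^ k * ‖a - b‖ ≤ ‖a - b‖ := mul_le_of_le_one_left (norm_nonneg _) h1
    have h3 : ‖a ^ k - b ^ k‖ * ‖b‖ ≤ ‖a ^ k - b ^ k‖ := mul_le_of_le_one_right (norm_nonneg _) hb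
    push_cast
    linarith

lemma charFun_pow_bound {K : ℝ} {ν : Measure ℝ} [IsProbabilityMeasure ν] (h : StdMom K ν)
    (t : ℝ) (m : ℕ) (hm : t ^ 2 ≤ m) (hm0 : 0 < m) :
    ‖charFun ν ((√m)⁻¹ * t) ^ m - Complex.exp (-(t : ℂ) ^ 2 / 2)‖ ≤
      4 * (1 + K) * |t| ^ 3 * (√m)⁻¹ + t ^ 4 * (√m)⁻¹ ^ 2 := by
  have hmR : (0 : ℝ) < m := by exact_mod_cast hm0
  set r := (√(m : ℝ))⁻¹ with hr
  have hrp : 0 < r := by positivity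
  have hr2 : m * r ^ 2 = 1 := by
    rw [hr, inv_pow, Real.sq_sqrt hmR.le]; field_simp
  set s := r * t with hs
  have hs2 : s ^ 2 ≤ 1 := by
    have : s ^ 2 = r ^ 2 * t ^ 2 := by rw [hs]; ring
    rw [this]; nlinarith [sq_nonneg r]
  set b : ℂ := ((Real.exp (-s ^ 2 / 2) : ℝ) : ℂ) with hb
  have hbm : b ^ m = Complex.exp (-(t : ℂ) ^ 2 / 2) := by
    rw [hb, ← Complex.ofReal_pow, ← Real.exp_nat_mul]
    push_cast
    congr 1
    have : (m : ℂ) * (r : ℂ) ^ 2 = 1 := by exact_mod_cast hr2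
    rw [hs]; push_cast
    linear_combination (-(t : ℂ) ^ 2 / 2) * this
  have hb1 : ‖b‖ ≤ 1 := by
    rw [hb, Complex.norm_real, Real.norm_eq_abs, Real.abs_exp, Real.exp_le_one_iff]
    nlinarith [sq_nonneg s]
  rw [← hbm]
  refine (norm_pow_sub_pow_le' (norm_charFun_le_one _) hb1 m).trans ?_
  have h1 := charFun_taylor h s
  have h2 : ‖(1 - (s : ℂ) ^ 2 / 2) - b‖ ≤ s ^ 4 := by
    have : (1 - (s : ℂ) ^ 2 / 2) - b = (((1 - s ^ 2 / 2 - Real.exp (-s ^ 2 / 2) : ℝ)) : ℂ) := by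
      rw [hb]; push_cast; ring
    rw [this, Complex.norm_real, Real.norm_eq_abs, abs_sub_comm]
    have h3 : |-s ^ 2 / 2| ≤ 1 := by
      rw [abs_le]; constructor <;> nlinarith [sq_nonneg s]
    have := Real.abs_exp_sub_one_sub_id_le h3
    calc _ = |Real.exp (-s ^ 2 / 2) - 1 - (-s ^ 2 / 2)| := by congr 1; ring
      _ ≤ _ := this
      _ ≤ s ^ 4 := by nlinarith [sq_nonneg (s ^ 2)]
  have h3 : ‖charFun ν s - b‖ ≤ 4 * (1 + K) * |s| ^ 3 + s ^ 4 := by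
    calc _ = ‖(charFun ν s - (1 - (s : ℂ) ^ 2 / 2)) + ((1 - (s : ℂ) ^ 2 / 2) - b)‖ := by
          congr 1; ring
      _ ≤ _ := (norm_add_le _ _).trans (add_le_add h1 h2)
  calc m * ‖charFun ν s - b‖ ≤ m * (4 * (1 + K) * |s| ^ 3 + s ^ 4) :=
        mul_le_mul_of_nonneg_left h3 hmR.le
    _ = _ := by
        rw [hs, abs_mul, abs_of_pos hrp]
        linear_combination (4 * (1 + K) * |t| ^ 3 * r + t ^ 4 * r ^ 2) * hr2

lemma charFun_pi_sum (m : ℕ) (ν : Measure ℝ) [IsProbabilityMeasure ν] (x t : ℝ) :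
    charFun ((Measure.pi fun _ : Fin m => ν).map (fun y => (√m)⁻¹ * ∑ i, y i + (-x))) t =
      charFun ν ((√m)⁻¹ * t) ^ m * Complex.exp (-(t * x) * Complex.I) := by
  rw [charFun_apply_real, integral_map (by fun_prop) (by fun_prop), charFun_apply_real]
  have h := integral_fintype_prod_eq_pow (ι := Fin m) (μ := ν)
    (fun x : ℝ => Complex.exp (((√m)⁻¹ * t : ℝ) * x * Complex.I))
  rw [Fintype.card_fin] at h
  rw [← h, ← integral_mul_const]
  congr 1
  ext y
  rw [← Complex.exp_sum, ← Complex.exp_add]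
  congr 1
  push_cast
  rw [← Finset.sum_mul, ← Finset.mul_sum]
  ring

lemma clt_seq (K : ℝ) (m : ℕ → ℕ) (hm : Tendsto m atTop atTop) (ν : ℕ → Measure ℝ)
    [∀ n, IsProbabilityMeasure (ν n)] (h : ∀ n, StdMom K (ν n)) (x : ℕ → ℝ) (x0 : ℝ)
    (hx : Tendsto x atTop (nhds x0)) :
    Tendsto (fun n => (Measure.pi fun _ : Fin (m n) => ν n).real
      {y | x n < (√(m n))⁻¹ * ∑ i, y i}) atTop (nhds (Φ (-x0))) := by
  let L : ∀ n, Measure ℝ := fun n => (Measure.pi fun _ : Fin (m n) => ν n).map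
    (fun y => (√(m n))⁻¹ * ∑ i, y i + (-x n))
  have hL : ∀ n, IsProbabilityMeasure (L n) := fun n =>
    Measure.isProbabilityMeasure_map (by fun_prop)
  let μs : ℕ → ProbabilityMeasure ℝ := fun n => ⟨L n, hL n⟩
  let μ0 : ProbabilityMeasure ℝ := ⟨gaussianReal (-x0) 1, inferInstance⟩
  have hconv : Tendsto μs atTop (nhds μ0) := by
    apply ProbabilityMeasure.tendsto_of_tendsto_charFun
    intro t
    have e1 : ∀ n, charFun (μs n : Measure ℝ) t = charFun (ν n) ((√(m n))⁻¹ * t) ^ (m n) *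
        Complex.exp (-(t * x n) * Complex.I) := fun n => charFun_pi_sum (m n) (ν n) (x n) t
    have e2 : charFun (μ0 : Measure ℝ) t = Complex.exp (-(t : ℂ) ^ 2 / 2) *
        Complex.exp (-(t * x0) * Complex.I) := by
      change charFun (gaussianReal (-x0) 1) t = _
      rw [charFun_gaussianReal, ← Complex.exp_add]
      congr 1
      push_cast
      ring
    simp_rw [e1]
    rw [e2]
    have hmR : Tendsto (fun n => (m n : ℝ)) atTop atTop := tendsto_natCast_atTop_atTop.comp hm
    have hinv : Tendsto (fun n => (√(m n : ℝ))⁻¹) atTop (nhds 0) :=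
      tendsto_inv_atTop_zero.comp (Real.tendsto_sqrt_atTop.comp hmR)
    refine Tendsto.mul ?_ ?_
    · rw [tendsto_iff_norm_sub_tendsto_zero]
      refine squeeze_zero' (g := fun n => 4 * (1 + K) * |t| ^ 3 * (√(m n : ℝ))⁻¹ +
        t ^ 4 * (√(m n : ℝ))⁻¹ ^ 2) (Eventually.of_forall fun n => norm_nonneg _) ?_ ?_
      · filter_upwards [hmR.eventually_ge_atTop (t ^ 2), hm.eventually_gt_atTop 0] with n h1 h2
        exact charFun_pow_bound (h n) t (m n) h1 h2
      · have := (hinv.const_mul (4 * (1 + K) * |t| ^ 3)).add ((hinv.pow 2).const_mul (t ^ 4))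
        simpa using this
    · have hc : Continuous fun y : ℝ => Complex.exp (-(t * y) * Complex.I) := by fun_prop
      exact (hc.tendsto x0).comp hx
  have hfr : (μ0 : Measure ℝ) (frontier (Set.Ioi 0)) = 0 := by
    have : NullSingletonClass (gaussianReal (-x0) 1) := nullSingletonClass_gaussianReal one_ne_zero
    rw [frontier_Ioi]
    exact measure_singleton (μ := gaussianReal (-x0) 1) 0
  have h1 := ProbabilityMeasure.tendsto_measure_of_null_frontier_of_tendsto' hconv hfr
  have h2 := (ENNReal.tendsto_toReal (measure_ne_top _ _)).comp h1
  have h3 : ((μ0 : Measure ℝ) (Set.Ioi 0)).toReal = Φ (-x0) := gaussian_shift_Ioi x0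
  rw [h3] at h2
  refine h2.congr fun n => ?_
  change ((L n) (Set.Ioi 0)).toReal = _
  rw [Measure.map_apply (by fun_prop) measurableSet_Ioi, ← measureReal_def]
  congr 1
  ext y
  simp

lemma clt_unif (K R η : ℝ) (hη : 0 < η) : ∃ N : ℕ, ∀ m : ℕ, N ≤ m → ∀ ν : Measure ℝ,
    IsProbabilityMeasure ν → StdMom K ν → ∀ x : ℝ, |x| ≤ R →
    |(Measure.pi fun _ : Fin m => ν).real {y | x < (√m)⁻¹ * ∑ i, y i} - Φ (-x)| ≤ η := by
  by_contra! hcon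
  choose m hm ν hν hmom x hx hlt using hcon
  obtain ⟨x0, -, φ, hφ, hlim⟩ := tendsto_subseq_of_bounded (s := Metric.closedBall (0 : ℝ) R)
    Metric.isBounded_closedBall (x := x) (fun n => by simpa using hx n)
  have hmt : Tendsto (fun n => m (φ n)) atTop atTop :=
    (tendsto_atTop_mono hm tendsto_id).comp hφ.tendsto_atTop
  have hν' : ∀ n, IsProbabilityMeasure (ν (φ n)) := fun n => hν _
  have h1 := clt_seq K (fun n => m (φ n)) hmt (fun n => ν (φ n)) (fun n => hmom _)
    (fun n => x (φ n)) x0 hlim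
  have h2 : Tendsto (fun n => Φ (-x (φ n))) atTop (nhds (Φ (-x0))) :=
    (Phi_continuous.tendsto _).comp hlim.neg
  have h3 := (h1.sub h2).abs
  simp only [sub_self, abs_zero] at h3
  obtain ⟨n, hn⟩ := (h3.eventually (gt_mem_nhds hη)).exists
  exact absurd hn (not_lt.2 (hlt (φ n)).le)

end

section
/-! ### Chebyshev for i.i.d. averages -/

lemma pi_var_mean {E : Type*} [MeasurableSpace E] (P : Measure E) [IsProbabilityMeasure P]
    (g : E → ℝ) (hg : MemLp g 2 P) (m : ℕ) (hm : 0 < m) :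
    Var[fun ω : Fin m → E => (∑ i, g (ω i)) / m; Measure.pi fun _ : Fin m => P]
      = Var[g; P] / m := by
  have h := variance_sum_pi (ι := Fin m) (μ := fun _ => P) (X := fun _ => g) (fun _ => hg)
  have e : (fun ω : Fin m → E => (∑ i, g (ω i)) / m) =
      fun ω => (m : ℝ)⁻¹ * (∑ i : Fin m, fun ω : Fin m → E => g (ω i)) ω := by
    ext ω; simp [Finset.sum_apply, div_eq_inv_mul]
  rw [e, variance_const_mul, h]
  simp
  have : (m : ℝ) ≠ 0 := by positivity
  field_simp

lemma memLp_comp_eval {E : Type*} [MeasurableSpace E] (P : Measure E) [IsProbabilityMeasure P]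
    (g : E → ℝ) {p : ENNReal} (hg : MemLp g p P) (m : ℕ) (i : Fin m) :
    MemLp (fun ω : Fin m → E => g (ω i)) p (Measure.pi fun _ : Fin m => P) :=
  hg.comp_measurePreserving (measurePreserving_eval (fun _ : Fin m => P) i)

lemma integral_comp_eval {E : Type*} [MeasurableSpace E] (P : Measure E) [IsProbabilityMeasure P]
    (g : E → ℝ) (hg : AEStronglyMeasurable g P) (m : ℕ) (i : Fin m) :
    ∫ ω : Fin m → E, g (ω i) ∂(Measure.pi fun _ : Fin m => P) = ∫ x, g x ∂P := by
  have h := measurePreserving_eval (fun _ : Fin m => P) i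
  have h2 := integral_map (μ := Measure.pi fun _ : Fin m => P) (φ := Function.eval i)
    (f := g) h.measurable.aemeasurable (by rw [h.map_eq]; exact hg)
  rw [h.map_eq] at h2
  exact h2.symm

lemma pi_integral_mean {E : Type*} [MeasurableSpace E] (P : Measure E) [IsProbabilityMeasure P]
    (g : E → ℝ) (hg : Integrable g P) (m : ℕ) (hm : 0 < m) :
    ∫ ω : Fin m → E, (∑ i, g (ω i)) / m ∂(Measure.pi fun _ : Fin m => P) = ∫ x, g x ∂P := by
  rw [integral_div, integral_finsetSum]
  · simp_rw [integral_comp_eval P g hg.aestronglyMeasurable m]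
    simp
    have : (m : ℝ) ≠ 0 := by positivity
    field_simp
  · intro i _
    exact memLp_one_iff_integrable.1 (memLp_comp_eval P g (memLp_one_iff_integrable.2 hg) m i)

lemma pi_cheb {E : Type*} [MeasurableSpace E] (P : Measure E) [IsProbabilityMeasure P]
    (g : E → ℝ) (hg : MemLp g 2 P) (m : ℕ) (hm : 0 < m) (c : ℝ) (hc : 0 < c) :
    (Measure.pi fun _ : Fin m => P).real {ω | c ≤ |(∑ i, g (ω i)) / m - ∫ x, g x ∂P|} ≤
      Var[g; P] / (m * c ^ 2) := by
  have hX : MemLp (fun ω : Fin m → E => (∑ i, g (ω i)) / m) 2 (Measure.pi fun _ : Fin m => P) := by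
    have := (memLp_finsetSum (μ := Measure.pi fun _ : Fin m => P) Finset.univ
      (fun i _ => memLp_comp_eval P g hg m i)).const_mul (m : ℝ)⁻¹
    refine this.congr_norm ?_ (ae_of_all _ fun ω => ?_)
    · exact (this.aestronglyMeasurable).congr (ae_of_all _ fun ω => by
        simp [div_eq_inv_mul])
    · simp [div_eq_inv_mul]
  have h := meas_ge_le_variance_div_sq hX hc
  rw [pi_integral_mean P g (hg.integrable (by norm_num)) m hm, pi_var_mean P g hg m hm] at h
  rw [measureReal_def]
  refine (ENNReal.toReal_mono ENNReal.ofReal_ne_top h).trans ?_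
  rw [ENNReal.toReal_ofReal (div_nonneg (div_nonneg (variance_nonneg _ _) (by positivity))
    (by positivity)), div_div]

/-! ### Uniform asymptotics of the studentized statistic -/

/-- sample standard deviation -/
def sdev (m : ℕ) (u : Fin m → ℝ) : ℝ := √((∑ i, (u i - (∑ j, u j) / m) ^ 2) / m)

lemma sdev_sq_eq (m : ℕ) (hm : 0 < m) (u : Fin m → ℝ) :
    (∑ i, (u i - (∑ j, u j) / m) ^ 2) / m = (∑ i, u i ^ 2) / m - ((∑ i, u i) / m) ^ 2 := by
  have : (m : ℝ) ≠ 0 := by positivity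
  set b := (∑ j, u j) / (m : ℝ) with hb
  have hs : ∑ j, u j = m * b := by rw [hb]; field_simp
  simp_rw [sub_sq]
  rw [Finset.sum_add_distrib, Finset.sum_sub_distrib, ← Finset.sum_mul, ← Finset.mul_sum, hs]
  simp
  field_simp
  ring

lemma sdev_close (m : ℕ) (hm : 0 < m) (u : Fin m → ℝ) (ε : ℝ) (hε : 0 < ε) (hε1 : ε ≤ 1)
    (h1 : |(∑ i, u i ^ 2) / m - 1| < ε) (h2 : |(∑ i, u i) / m| < ε) :
    |sdev m u - 1| ≤ 2 * ε := by
  have hV : 0 ≤ sdev m u := Real.sqrt_nonneg _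
  have hV2 : sdev m u ^ 2 = (∑ i, u i ^ 2) / m - ((∑ i, u i) / m) ^ 2 := by
    rw [← sdev_sq_eq m hm, sdev, Real.sq_sqrt]
    positivity
  have hb : ((∑ i, u i) / (m : ℝ)) ^ 2 ≤ ε := by
    rw [← sq_abs]; nlinarith [abs_nonneg ((∑ i, u i) / (m : ℝ))]
  have hb0 := sq_nonneg ((∑ i, u i) / (m : ℝ))
  have h3 : |sdev m u ^ 2 - 1| ≤ 2 * ε := by
    rw [abs_lt] at h1
    rw [abs_le]; constructor <;> linarith
  have h4 : |sdev m u ^ 2 - 1| = |sdev m u - 1| * (sdev m u + 1) := by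
    rw [← abs_of_nonneg (by linarith : 0 ≤ sdev m u + 1), ← abs_mul]
    congr 1
    ring
  nlinarith [abs_nonneg (sdev m u - 1)]

lemma student_std (K z R η : ℝ) (hη : 0 < η) : ∃ N : ℕ, ∃ ε : ℝ, 0 < ε ∧ ∀ m : ℕ, N ≤ m →
    ∀ ν : Measure ℝ, IsProbabilityMeasure ν → StdMom K ν → ∀ a δ : ℝ, |δ| ≤ R → |a - δ| ≤ ε →
    |(Measure.pi fun _ : Fin m => ν).real
      {u | z < (a + (√m)⁻¹ * ∑ i, u i) / sdev m u} - Φ (δ - z)| ≤ η := by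
  set ε : ℝ := min (1 / 4) (min 1 (η / 4) / (1 + 2 * |z|)) with hεdef
  have hz0 : 0 < 1 + 2 * |z| := by positivity
  have hε : 0 < ε := by rw [hεdef]; positivity
  have hε4 : ε ≤ 1 / 4 := min_le_left _ _
  set c := ε * (1 + 2 * |z|) with hc
  have hcm : c ≤ min 1 (η / 4) := by
    have : ε ≤ min 1 (η / 4) / (1 + 2 * |z|) := min_le_right _ _
    rwa [le_div_iff₀ hz0] at this
  have hc1 : c ≤ 1 := hcm.trans (min_le_left _ _)
  have hcη : c ≤ η / 4 := hcm.trans (min_le_right _ _)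
  have hc0 : 0 < c := by positivity
  obtain ⟨N1, hN1⟩ := clt_unif K (|z| + R + 1) (η / 4) (by positivity)
  obtain ⟨N2, hN2⟩ := exists_nat_gt ((K + 1) / (ε ^ 2 * (η / 4)))
  refine ⟨max (max N1 N2) 1, ε, hε, fun m hm ν hν hmom a δ hδ haδ => ?_⟩
  have hmN1 : N1 ≤ m := (le_max_left _ _).trans ((le_max_left _ _).trans hm)
  have hmN2 : N2 ≤ m := (le_max_right _ _).trans ((le_max_left _ _).trans hm)
  have hm0 : 0 < m := (le_max_right _ _).trans hm
  have hmR : (0 : ℝ) < m := by exact_mod_cast hm0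
  set Q := Measure.pi fun _ : Fin m => ν with hQ
  -- bad events
  have i2 : MemLp (fun x : ℝ => x) 2 ν := by
    rw [memLp_two_iff_integrable_sq (by fun_prop)]
    simpa using integrable_pow_of_four hmom.int4 2 (by norm_num)
  have i4 : MemLp (fun x : ℝ => x ^ 2) 2 ν := by
    rw [memLp_two_iff_integrable_sq (by fun_prop)]
    simpa [← pow_mul] using hmom.int4
  have v1 : Var[fun x : ℝ => x; ν] ≤ 1 := by
    refine (variance_le_expectation_sq (by fun_prop)).trans ?_
    have := hmom.var
    simp only [Pi.pow_apply]
    rw [this]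
  have v2 : Var[fun x : ℝ => x ^ 2; ν] ≤ K := by
    refine (variance_le_expectation_sq (by fun_prop)).trans ?_
    have := hmom.m4
    simp only [Pi.pow_apply, ← pow_mul]
    exact this
  have b1 := pi_cheb ν (fun x : ℝ => x) i2 m hm0 ε hε
  have b2 := pi_cheb ν (fun x : ℝ => x ^ 2) i4 m hm0 ε hε
  simp only [hmom.mean, hmom.var, sub_zero] at b1 b2
  set B1 := {ω : Fin m → ℝ | ε ≤ |(∑ i, ω i) / (m : ℝ)|}
  set B2 := {ω : Fin m → ℝ | ε ≤ |(∑ i, ω i ^ 2) / (m : ℝ) - 1|}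
  have hB : Q.real (B1 ∪ B2) ≤ η / 4 := by
    have h1 : Q.real B1 ≤ 1 / (m * ε ^ 2) := b1.trans (by gcongr)
    have h2 : Q.real B2 ≤ K / (m * ε ^ 2) := b2.trans (by gcongr)
    have h3 : (K + 1) / (ε ^ 2 * (η / 4)) < m := hN2.trans_le (by exact_mod_cast hmN2)
    rw [div_lt_iff₀ (by positivity)] at h3
    have h4 : (1 + K) / (m * ε ^ 2) ≤ η / 4 := by
      rw [div_le_iff₀ (by positivity)]; linarith
    calc Q.real (B1 ∪ B2) ≤ Q.real B1 + Q.real B2 := measureReal_union_le _ _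
      _ ≤ 1 / (m * ε ^ 2) + K / (m * ε ^ 2) := add_le_add h1 h2
      _ = (1 + K) / (m * ε ^ 2) := by ring
      _ ≤ _ := h4
  have good : ∀ u : Fin m → ℝ, u ∉ B1 ∪ B2 → 0 < sdev m u ∧ |z * sdev m u - z| ≤ 2 * ε * |z| := by
    intro u hu
    simp only [B1, B2, Set.mem_union, Set.mem_ofPred_eq, not_or, not_le] at hu
    have := sdev_close m hm0 u ε hε (by linarith) hu.2 hu.1
    refine ⟨by rw [abs_le] at this; linarith, ?_⟩
    have e : z * sdev m u - z = z * (sdev m u - 1) := by ring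
    rw [e, abs_mul]
    nlinarith [abs_nonneg z]
  have hcexp : c = ε + 2 * ε * |z| := by rw [hc]; ring
  have hR : ∀ x : ℝ, |x - (z - δ)| ≤ 1 → |x| ≤ |z| + R + 1 := by
    intro x hx
    have : x = (x - (z - δ)) + z - δ := by ring
    rw [this]
    refine (abs_sub _ _).trans ?_
    have := abs_add_le (x - (z - δ)) z
    linarith
  have up := hN1 m hmN1 ν hν hmom (z - δ - c) (hR _ (by
    rw [show z - δ - c - (z - δ) = -c by ring, abs_neg, abs_of_pos hc0]; exact hc1))
  have lo := hN1 m hmN1 ν hν hmom (z - δ + c) (hR _ (by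
    rw [show z - δ + c - (z - δ) = c by ring, abs_of_pos hc0]; exact hc1))
  rw [abs_le] at up lo haδ
  set A := {u : Fin m → ℝ | z < (a + (√m)⁻¹ * ∑ i, u i) / sdev m u}
  have sub1 : A ⊆ {u | z - δ - c < (√m)⁻¹ * ∑ i, u i} ∪ (B1 ∪ B2) := by
    intro u hu
    by_cases hb : u ∈ B1 ∪ B2
    · exact Or.inr hb
    · left
      obtain ⟨g1, g2⟩ := good u hb
      simp only [A, Set.mem_ofPred_eq] at hu ⊢
      rw [lt_div_iff₀ g1] at hu
      rw [abs_le] at g2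
      linarith
  have sub2 : {u | z - δ + c < (√m)⁻¹ * ∑ i, u i} ⊆ A ∪ (B1 ∪ B2) := by
    intro u hu
    by_cases hb : u ∈ B1 ∪ B2
    · exact Or.inr hb
    · left
      obtain ⟨g1, g2⟩ := good u hb
      simp only [A, Set.mem_ofPred_eq] at hu ⊢
      rw [lt_div_iff₀ g1]
      rw [abs_le] at g2
      linarith
  have m1 := (measureReal_mono (μ := Q) sub1).trans (measureReal_union_le _ _)
  have m2 := (measureReal_mono (μ := Q) sub2).trans (measureReal_union_le _ _)
  have p1 := Phi_sub_le (a := δ - z) (b := -(z - δ - c)) (by linarith)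
  have p2 := Phi_sub_le (a := -(z - δ + c)) (b := δ - z) (by linarith)
  rw [abs_le]
  constructor <;> linarith [up.1, up.2, lo.1, lo.2]

lemma studentized_affine (m : ℕ) (hm : 0 < m) (μ σ : ℝ) (hσ : 0 < σ) (u : Fin m → ℝ) :
    studentized m (fun i => μ + σ * u i) = (√m * μ / σ + (√m)⁻¹ * ∑ i, u i) / sdev m u := by
  have hmR : (0 : ℝ) < m := by exact_mod_cast hm
  have hs : ∑ i, (μ + σ * u i) = m * μ + σ * ∑ i, u i := by
    rw [Finset.sum_add_distrib, ← Finset.mul_sum]; simp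
  have h1 : ∀ i, μ + σ * u i - (m * μ + σ * ∑ i, u i) / m = σ * (u i - (∑ j, u j) / m) := by
    intro i; field_simp; ring
  unfold studentized
  rw [hs]
  simp_rw [h1, mul_pow]
  rw [← Finset.mul_sum, mul_div_assoc (σ ^ 2), Real.sqrt_mul (sq_nonneg σ), Real.sqrt_sq hσ.le]
  change _ / (σ * sdev m u) = _
  rw [← div_div]
  congr 1
  have hsq : √(m : ℝ) * √m = m := Real.mul_self_sqrt hmR.le
  have hsp : 0 < √(m : ℝ) := Real.sqrt_pos.2 hmR
  field_simp
  rw [show √(m : ℝ) ^ 2 = m by rw [sq, hsq]]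

lemma student_unif (K z R η : ℝ) (hη : 0 < η) : ∃ N : ℕ, ∃ ε : ℝ, 0 < ε ∧ ∀ m : ℕ, N ≤ m →
    ∀ (E : Type) (_ : MeasurableSpace E) (P : Measure E) (_ : IsProbabilityMeasure P) (f : E → ℝ)
      (μ σ : ℝ), Measurable f → 0 < σ → Integrable (fun x => (f x - μ) ^ 4) P →
      ∫ x, (f x - μ) ∂P = 0 → ∫ x, (f x - μ) ^ 2 ∂P = σ ^ 2 →
      ∫ x, (f x - μ) ^ 4 ∂P ≤ K * σ ^ 4 →
      ∀ δ : ℝ, |δ| ≤ R → |√m * μ / σ - δ| ≤ ε →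
    |(Measure.pi fun _ : Fin m => P).real
      {ω | z < studentized m (fun i => f (ω i))} - Φ (δ - z)| ≤ η := by
  obtain ⟨N, ε, hε, h⟩ := student_std K z R η hη
  refine ⟨max N 1, ε, hε, fun m hm E _ P hP f μ σ hf hσ i4 h1 h2 h4 δ hδ haδ => ?_⟩
  have hm0 : 0 < m := (le_max_right _ _).trans hm
  have hmeas : Measurable (fun x => (f x - μ) / σ) := by fun_prop
  set ν := P.map (fun x => (f x - μ) / σ) with hν
  have hνp : IsProbabilityMeasure ν := Measure.isProbabilityMeasure_map (by fun_prop)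
  have hmom : StdMom K ν := by
    refine ⟨?_, ?_, ?_, ?_⟩
    · rw [hν, integrable_map_measure (by fun_prop) (by fun_prop)]
      have := i4.div_const (σ ^ 4)
      refine this.congr (ae_of_all _ fun x => ?_)
      simp [div_pow]
    · rw [hν, integral_map (by fun_prop) (by fun_prop), integral_div, h1, zero_div]
    · rw [hν, integral_map (by fun_prop) (by fun_prop)]
      simp_rw [div_pow]
      rw [integral_div, h2, div_self (by positivity)]
    · rw [hν, integral_map (by fun_prop) (by fun_prop)]
      simp_rw [div_pow]
      rw [integral_div, div_le_iff₀ (by positivity)]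
      exact h4
  have key := h m ((le_max_left _ _).trans hm) ν hνp hmom (√m * μ / σ) δ hδ haδ
  have hpi : (Measure.pi fun _ : Fin m => P).map (fun ω i => (f (ω i) - μ) / σ) =
      Measure.pi fun _ : Fin m => ν :=
    Measure.pi_map_pi (μ := fun _ : Fin m => P) (f := fun _ x => (f x - μ) / σ)
      (fun _ => hmeas.aemeasurable)
  have hms : MeasurableSet {u : Fin m → ℝ | z < (√m * μ / σ + (√m)⁻¹ * ∑ i, u i) / sdev m u} := by
    apply measurableSet_lt measurable_const
    unfold sdev
    fun_prop
  rw [← hpi, map_measureReal_apply (by fun_prop) hms] at key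
  convert! key using 4
  ext ω
  simp only [Set.mem_ofPred_eq, Set.mem_preimage]
  rw [← studentized_affine m hm0 μ σ hσ]
  have : ∀ i, μ + σ * ((f (ω i) - μ) / σ) = f (ω i) := by intro i; field_simp; ring
  simp_rw [this]

end

section
abbrev g1 : Measure ℝ := gaussianReal 0 1

lemma g1_integrable_pow (n : ℕ) : Integrable (fun x : ℝ => x ^ n) g1 := by
  have h := memLp_id_gaussianReal (μ := 0) (v := 1) (n : NNReal)
  have h2 := h.integrable_norm_pow'
  rw [← integrable_norm_iff (by fun_prop)]
  simpa [norm_pow] using h2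

lemma g1_int_sq : ∫ x, x ^ 2 ∂g1 = 1 := by
  have h := variance_id_gaussianReal (μ := 0) (v := 1)
  rw [variance_eq_integral (by fun_prop)] at h
  simpa [integral_id_gaussianReal] using h

lemma deriv_mul_gexp (p p' : ℝ → ℝ) (hp : ∀ t, HasDerivAt p (p' t) t) :
    deriv (fun t => p t * Real.exp (t ^ 2 / 2)) =
      fun t => (p' t + t * p t) * Real.exp (t ^ 2 / 2) := by
  ext t
  have h1 : HasDerivAt (fun t : ℝ => t ^ 2 / 2) t t := by
    exact ((hasDerivAt_pow 2 t).div_const 2).congr_deriv (by norm_num)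
  have := ((hp t).mul h1.exp).deriv
  rw [show (fun t => p t * Real.exp (t ^ 2 / 2)) = p * fun t => Real.exp (t ^ 2 / 2) from rfl, this]
  ring

lemma g1_int_four : ∫ x, x ^ 4 ∂g1 = 3 := by
  have h := iteratedDeriv_mgf_zero (X := fun x : ℝ => x) (μ := g1)
    (by rw [integrableExpSet_fun_id_gaussianReal]; simp) 4
  rw [mgf_fun_id_gaussianReal] at h
  have e0 : (fun t : ℝ => Real.exp (0 * t + ((1 : NNReal) : ℝ) * t ^ 2 / 2)) =
      fun t => (fun _ => (1:ℝ)) t * Real.exp (t ^ 2 / 2) := by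
    ext t; simp
  rw [e0, iteratedDeriv_succ, iteratedDeriv_succ, iteratedDeriv_succ, iteratedDeriv_one,
    deriv_mul_gexp _ (fun _ => 0) (fun t => hasDerivAt_const t 1),
    deriv_mul_gexp (fun t => 0 + t * 1) (fun _ => 1) (fun t => by
      rw [show (fun t : ℝ => 0 + t * 1) = id by ext; simp]
      exact hasDerivAt_id t),
    deriv_mul_gexp (fun t => 1 + t * (0 + t * 1)) (fun t => 2 * t) (fun t => by
      rw [show (fun t : ℝ => 1 + t * (0 + t * 1)) = fun t => 1 + t ^ 2 by ext; ring]
      exact ((hasDerivAt_pow 2 t).const_add 1).congr_deriv (by norm_num)),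
    deriv_mul_gexp (fun t => 2 * t + t * (1 + t * (0 + t * 1))) (fun t => 3 + 3 * t ^ 2) (fun t => by
      rw [show (fun t : ℝ => 2 * t + t * (1 + t * (0 + t * 1))) =
        (fun x => x ^ 3) + fun y => 3 * id y by ext; simp; ring]
      exact ((hasDerivAt_pow 3 t).add ((hasDerivAt_id t).const_mul 3)).congr_deriv
        (by norm_num; ring))] at h
  simp at h
  exact h.symm

lemma g1_int_xi : ∫ x, (x ^ 2 - 1) ∂g1 = 0 := by
  rw [integral_sub (g1_integrable_pow 2) (integrable_const _), g1_int_sq]; simp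

lemma g1_int_xi_sq : ∫ x, (x ^ 2 - 1) ^ 2 ∂g1 = 2 := by
  have : (fun x : ℝ => (x ^ 2 - 1) ^ 2) = fun x => x ^ 4 - 2 * x ^ 2 + 1 := by ext; ring
  rw [this, integral_add, integral_sub, integral_const_mul, g1_int_sq, g1_int_four]
  · simp; norm_num
  · exact g1_integrable_pow 4
  · exact (g1_integrable_pow 2).const_mul _
  · exact (g1_integrable_pow 4).sub ((g1_integrable_pow 2).const_mul _)
  · exact integrable_const _

/-- moments of sums of independent centered variables -/
lemma indep_add_mom {Ω : Type*} [MeasurableSpace Ω] (μ : Measure Ω) [IsProbabilityMeasure μ]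
    (X S : Ω → ℝ) (hX : MemLp X 4 μ) (hS : MemLp S 4 μ) (hi : IndepFun S X μ)
    (hX0 : ∫ ω, X ω ∂μ = 0) (hS0 : ∫ ω, S ω ∂μ = 0) :
    ∫ ω, (X ω + S ω) ^ 2 ∂μ = ∫ ω, X ω ^ 2 ∂μ + ∫ ω, S ω ^ 2 ∂μ ∧
    ∫ ω, (X ω + S ω) ^ 4 ∂μ = ∫ ω, X ω ^ 4 ∂μ + 6 * (∫ ω, X ω ^ 2 ∂μ) * (∫ ω, S ω ^ 2 ∂μ)
      + ∫ ω, S ω ^ 4 ∂μ := by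
  have ip : ∀ (Y : Ω → ℝ), MemLp Y 4 μ → ∀ k : ℕ, k ≤ 4 → Integrable (fun ω => Y ω ^ k) μ := by
    intro Y hY k hk
    have h2 : MemLp Y (k : ENNReal) μ := hY.mono_exponent (by exact_mod_cast hk)
    have h3 := h2.integrable_norm_pow'
    rw [← integrable_norm_iff (by have := hY.aestronglyMeasurable; fun_prop)]
    simpa [norm_pow] using h3
  have ij : ∀ j k : ℕ, j ≤ 4 → k ≤ 4 → Integrable (fun ω => S ω ^ j * X ω ^ k) μ ∧
      ∫ ω, S ω ^ j * X ω ^ k ∂μ = (∫ ω, S ω ^ j ∂μ) * ∫ ω, X ω ^ k ∂μ := by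
    intro j k hj hk
    have hI : IndepFun (fun ω => S ω ^ j) (fun ω => X ω ^ k) μ :=
      hi.comp (φ := fun x => x ^ j) (ψ := fun x => x ^ k) (by fun_prop) (by fun_prop)
    exact ⟨hI.integrable_mul (ip S hS j hj) (ip X hX k hk),
      hI.integral_fun_mul_eq_mul_integral (ip S hS j hj).1 (ip X hX k hk).1⟩
  constructor
  · have e : (fun ω => (X ω + S ω) ^ 2) = fun ω => X ω ^ 2 + S ω ^ 2 + 2 * (S ω ^ 1 * X ω ^ 1) := by
      ext ω; ring
    have i12 : Integrable (fun ω => X ω ^ 2 + S ω ^ 2) μ :=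
      (ip X hX 2 (by norm_num)).add (ip S hS 2 (by norm_num))
    rw [e, integral_add i12
      ((ij 1 1 (by norm_num) (by norm_num)).1.const_mul _),
      integral_add (ip X hX 2 (by norm_num)) (ip S hS 2 (by norm_num)), integral_const_mul,
      (ij 1 1 (by norm_num) (by norm_num)).2]
    simp [hX0]
  · have e : (fun ω => (X ω + S ω) ^ 4) = fun ω => X ω ^ 4 + S ω ^ 4 + 6 * (S ω ^ 2 * X ω ^ 2)
        + (4 * (S ω ^ 1 * X ω ^ 3) + 4 * (S ω ^ 3 * X ω ^ 1)) := by
      ext ω; ring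
    have i1 := (ij 2 2 (by norm_num) (by norm_num)).1.const_mul 6
    have i2 := (ij 1 3 (by norm_num) (by norm_num)).1.const_mul 4
    have i3 := (ij 3 1 (by norm_num) (by norm_num)).1.const_mul 4
    have i4 := (ip X hX 4 (by norm_num))
    have i5 := (ip S hS 4 (by norm_num))
    have i45 : Integrable (fun ω => X ω ^ 4 + S ω ^ 4) μ := i4.add i5
    have i451 : Integrable (fun ω => X ω ^ 4 + S ω ^ 4 + 6 * (S ω ^ 2 * X ω ^ 2)) μ := i45.add i1
    have i23 : Integrable (fun ω => 4 * (S ω ^ 1 * X ω ^ 3) + 4 * (S ω ^ 3 * X ω ^ 1)) μ := i2.add i3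
    rw [e, integral_add i451 i23, integral_add i45 i1,
      integral_add i4 i5, integral_add i2 i3, integral_const_mul, integral_const_mul,
      integral_const_mul, (ij 2 2 (by norm_num) (by norm_num)).2,
      (ij 1 3 (by norm_num) (by norm_num)).2, (ij 3 1 (by norm_num) (by norm_num)).2]
    simp [hX0, hS0]; ring

abbrev gam (d : ℕ) : Measure (Fin d → ℝ) := Measure.pi fun _ : Fin d => g1

def K4 : ℝ := (∫ x, (x ^ 2 - 1) ^ 4 ∂g1) + 12

lemma K4_nonneg : 0 ≤ K4 := by
  have : 0 ≤ ∫ x, (x ^ 2 - 1) ^ 4 ∂g1 := integral_nonneg (fun x => by positivity)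
  unfold K4; linarith

lemma g1_memLp_xi : MemLp (fun x : ℝ => x ^ 2 - 1) 4 g1 := by
  rw [← integrable_norm_rpow_iff (by fun_prop) (by norm_num) (by norm_num)]
  have e : (fun x : ℝ => ‖x ^ 2 - 1‖ ^ (4 : ENNReal).toReal) = fun x =>
      x ^ 8 - 4 * x ^ 6 + 6 * x ^ 4 - 4 * x ^ 2 + 1 := by
    ext x
    have : ((4 : ENNReal).toReal) = ((4 : ℕ) : ℝ) := by simp
    rw [this, Real.rpow_natCast, Real.norm_eq_abs, Even.pow_abs (by decide)]
    ring
  rw [e]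
  exact ((((g1_integrable_pow 8).sub ((g1_integrable_pow 6).const_mul 4)).add
    ((g1_integrable_pow 4).const_mul 6)).sub ((g1_integrable_pow 2).const_mul 4)).add
    (integrable_const 1)

lemma gam_diag (d : ℕ) (l : Fin d → ℝ) (s : Finset (Fin d)) :
    MemLp (fun z : Fin d → ℝ => ∑ k ∈ s, l k * (z k ^ 2 - 1)) 4 (gam d) ∧
    ∫ z, (∑ k ∈ s, l k * (z k ^ 2 - 1)) ∂(gam d) = 0 ∧
    ∫ z, (∑ k ∈ s, l k * (z k ^ 2 - 1)) ^ 2 ∂(gam d) = 2 * ∑ k ∈ s, l k ^ 2 ∧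
    ∫ z, (∑ k ∈ s, l k * (z k ^ 2 - 1)) ^ 4 ∂(gam d) ≤ K4 * (∑ k ∈ s, l k ^ 2) ^ 2 := by
  classical
  have hm1 : ∀ k, MemLp (fun z : Fin d → ℝ => l k * (z k ^ 2 - 1)) 4 (gam d) := fun k =>
    (memLp_comp_eval g1 (fun x => x ^ 2 - 1) g1_memLp_xi d k).const_mul _
  have hz : ∀ k, ∫ z : Fin d → ℝ, l k * (z k ^ 2 - 1) ∂(gam d) = 0 := by
    intro k
    rw [integral_const_mul, integral_comp_eval g1 (fun x => x ^ 2 - 1) (by fun_prop), g1_int_xi]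
    simp
  have hind : iIndepFun (fun k (z : Fin d → ℝ) => l k * (z k ^ 2 - 1)) (gam d) :=
    iIndepFun_pi (X := fun k x => l k * (x ^ 2 - 1)) (fun k => by fun_prop)
  induction s using Finset.induction_on with
  | empty => simp
  | insert a s ha ih =>
    obtain ⟨h1, h2, h3, h4⟩ := ih
    have hI := hind.indepFun_finsetSum_of_notMem (fun i => by fun_prop) ha
    have hI' : IndepFun (fun z : Fin d → ℝ => ∑ k ∈ s, l k * (z k ^ 2 - 1))
        (fun z => l a * (z a ^ 2 - 1)) (gam d) := by
      convert hI using 1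
      ext z; simp
    obtain ⟨q2, q4⟩ := indep_add_mom (gam d) _ _ (hm1 a) h1 hI' (hz a) h2
    simp only [Finset.sum_insert ha]
    refine ⟨(hm1 a).add h1, ?_, ?_, ?_⟩
    · rw [integral_add ((hm1 a).integrable (by norm_num)) (h1.integrable (by norm_num)), hz, h2]
      simp
    · rw [q2, h3]
      simp only [mul_pow]
      rw [integral_const_mul, integral_comp_eval g1 (fun x => (x ^ 2 - 1) ^ 2) (by fun_prop),
        g1_int_xi_sq]
      ring
    · rw [q4, h3]
      simp only [mul_pow]
      rw [integral_const_mul, integral_const_mul,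
        integral_comp_eval g1 (fun x => (x ^ 2 - 1) ^ 2) (by fun_prop), g1_int_xi_sq,
        integral_comp_eval g1 (fun x => (x ^ 2 - 1) ^ 4) (by fun_prop)]
      have hK : ∫ x, (x ^ 2 - 1) ^ 4 ∂g1 = K4 - 12 := by unfold K4; ring
      rw [hK]
      have hK' : 12 ≤ K4 := by
        have : 0 ≤ ∫ x, (x ^ 2 - 1) ^ 4 ∂g1 := integral_nonneg (fun x => by positivity)
        unfold K4; linarith
      have hA : 0 ≤ ∑ k ∈ s, l k ^ 2 := Finset.sum_nonneg fun i _ => sq_nonneg _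
      set A := ∑ k ∈ s, l k ^ 2
      have hl := sq_nonneg (l a)
      have e : l a ^ 4 = (l a ^ 2) ^ 2 := by ring
      rw [e]
      set B := l a ^ 2
      nlinarith [mul_nonneg hA hl, mul_nonneg (sub_nonneg.2 hK') (mul_nonneg hA hl), sq_nonneg B]

end

section
lemma map_dot_gam {d : ℕ} (u : Fin d → ℝ) :
    (gam d).map (fun x => dot u x) = gaussianReal 0 (Real.toNNReal (∑ i, u i ^ 2)) := by
  have hm : Measurable (fun x : Fin d → ℝ => dot u x) := by unfold dot; fun_prop
  have : IsProbabilityMeasure ((gam d).map (fun x => dot u x)) :=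
    Measure.isProbabilityMeasure_map hm.aemeasurable
  apply Measure.ext_of_charFun
  ext t
  rw [charFun_apply_real, integral_map hm.aemeasurable (by fun_prop), charFun_gaussianReal]
  have e : (fun x : Fin d → ℝ => Complex.exp (t * (dot u x : ℝ) * Complex.I)) =
      fun x => ∏ i, Complex.exp (((t * u i : ℝ) : ℂ) * (x i : ℝ) * Complex.I) := by
    ext x
    rw [← Complex.exp_sum]
    congr 1
    unfold dot
    push_cast
    rw [Finset.mul_sum, Finset.sum_mul]
    exact Finset.sum_congr rfl fun i _ => by ring
  rw [e, integral_fintype_prod_eq_prod (fun i (x : ℝ) =>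
    Complex.exp (((t * u i : ℝ) : ℂ) * (x : ℝ) * Complex.I))]
  simp only [← charFun_apply_real, charFun_gaussianReal]
  rw [← Complex.exp_sum]
  congr 1
  rw [Real.coe_toNNReal _ (Finset.sum_nonneg fun i _ => sq_nonneg _)]
  push_cast
  simp [Finset.sum_mul, Finset.sum_div]
  exact Finset.sum_congr rfl fun i _ => by ring

lemma ext_of_map_dot {d : ℕ} (P Q : Measure (Fin d → ℝ)) [IsProbabilityMeasure P]
    [IsProbabilityMeasure Q]
    (h : ∀ u : Fin d → ℝ, P.map (fun x => dot u x) = Q.map (fun x => dot u x)) : P = Q := by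
  apply Measure.ext_of_charFunDual
  ext L
  rw [charFunDual_eq_charFun_map_one, charFunDual_eq_charFun_map_one]
  have : (L : (Fin d → ℝ) → ℝ) = fun x => dot (fun i => L (Pi.single i 1)) x := by
    ext x
    unfold dot
    conv_lhs => rw [← Finset.univ_sum_single x]
    rw [map_sum]
    refine Finset.sum_congr rfl fun i _ => ?_
    have : (Pi.single i (x i) : Fin d → ℝ) = x i • Pi.single i 1 := by
      rw [← Pi.single_smul]; simp
    rw [this, map_smul, smul_eq_mul, mul_comm]
  rw [this, h]

lemma dot_mulVec {d : ℕ} (u x : Fin d → ℝ) (M : Matrix (Fin d) (Fin d) ℝ) :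
    dot u (M.mulVec x) = dot (M.transpose.mulVec u) x := by
  change u ⬝ᵥ _ = _ ⬝ᵥ x
  rw [Matrix.mulVec_transpose, Matrix.dotProduct_mulVec]

lemma measurable_mulVec {d : ℕ} (M : Matrix (Fin d) (Fin d) ℝ) : Measurable (fun x => M.mulVec x) := by
  unfold Matrix.mulVec dotProduct; fun_prop

lemma gauss_eq_map {d : ℕ} (P : Measure (Fin d → ℝ)) (S M : Matrix (Fin d) (Fin d) ℝ)
    (hP : IsGaussianVec P 0 S) (hS : S = M * M.transpose) :
    P = (gam d).map (fun x => M.mulVec x) := by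
  obtain ⟨h1, h2, h3⟩ := hP
  have : IsProbabilityMeasure ((gam d).map (fun x => M.mulVec x)) :=
    Measure.isProbabilityMeasure_map (measurable_mulVec M).aemeasurable
  apply ext_of_map_dot
  intro u
  rw [h3, Measure.map_map (by unfold dot; fun_prop) (measurable_mulVec M)]
  have : ((fun x => dot u x) ∘ fun x => M.mulVec x) = fun x => dot (M.transpose.mulVec u) x := by
    ext x; exact dot_mulVec u x M
  rw [this, map_dot_gam]
  congr 2
  · simp [dot]
  · rw [hS, ← Matrix.mulVec_mulVec, dot_mulVec]
    unfold dot
    exact Finset.sum_congr rfl fun i _ => by ring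

lemma gam_rot {d : ℕ} (U : Matrix (Fin d) (Fin d) ℝ) (hU : U * U.transpose = 1) :
    (gam d).map (fun x => U.mulVec x) = gam d := by
  symm
  apply gauss_eq_map (gam d) 1 U _ hU.symm
  refine ⟨inferInstance, by simp [Matrix.IsSymm], fun u => ?_⟩
  rw [map_dot_gam]
  congr 2
  · simp [dot]
  · simp [dot, pow_two]

lemma spec {d : ℕ} (C : Matrix (Fin d) (Fin d) ℝ) (hC : C.IsSymm) :
    ∃ (U : Matrix (Fin d) (Fin d) ℝ) (l : Fin d → ℝ), U * U.transpose = 1 ∧ U.transpose * U = 1 ∧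
      C = U * Matrix.diagonal l * U.transpose := by
  have hH : C.IsHermitian := by
    unfold Matrix.IsHermitian; rw [Matrix.conjTranspose_eq_transpose_of_trivial]; exact hC
  refine ⟨hH.eigenvectorUnitary, hH.eigenvalues, ?_, ?_, ?_⟩
  · have := Unitary.mul_star_self_of_mem hH.eigenvectorUnitary.2
    rwa [Matrix.star_eq_conjTranspose, Matrix.conjTranspose_eq_transpose_of_trivial] at this
  · have := Unitary.star_mul_self_of_mem hH.eigenvectorUnitary.2
    rwa [Matrix.star_eq_conjTranspose, Matrix.conjTranspose_eq_transpose_of_trivial] at this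
  · have := hH.spectral_theorem
    rw [Unitary.conjStarAlgAut_apply] at this
    rw [Matrix.star_eq_conjTranspose, Matrix.conjTranspose_eq_transpose_of_trivial] at this
    exact this

lemma frobSq_eq_trace {d : ℕ} (C : Matrix (Fin d) (Fin d) ℝ) : 
    frobSq C = Matrix.trace (C * C.transpose) := by
  simp [frobSq, Matrix.trace, Matrix.mul_apply, pow_two]

lemma frobSq_spec {d : ℕ} (U : Matrix (Fin d) (Fin d) ℝ) (l : Fin d → ℝ)
    (hU : U.transpose * U = 1) :
    frobSq (U * Matrix.diagonal l * U.transpose) = ∑ k, l k ^ 2 := by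
  rw [frobSq_eq_trace]
  simp only [Matrix.transpose_mul, Matrix.transpose_transpose, Matrix.diagonal_transpose]
  have : U * Matrix.diagonal l * U.transpose * (U * (Matrix.diagonal l * U.transpose)) =
      U * (Matrix.diagonal l * (U.transpose * U) * Matrix.diagonal l * U.transpose) := by
    simp only [Matrix.mul_assoc]
  rw [this, hU, Matrix.trace_mul_comm]
  rw [Matrix.mul_one, Matrix.mul_assoc, hU, Matrix.mul_one, Matrix.diagonal_mul_diagonal,
    Matrix.trace_diagonal]
  exact Finset.sum_congr rfl fun i _ => by ring

lemma trace_spec {d : ℕ} (U : Matrix (Fin d) (Fin d) ℝ) (l : Fin d → ℝ)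
    (hU : U.transpose * U = 1) :
    Matrix.trace (U * Matrix.diagonal l * U.transpose) = ∑ k, l k := by
  rw [Matrix.mul_assoc, Matrix.trace_mul_comm, Matrix.mul_assoc, hU, Matrix.mul_one,
    Matrix.trace_diagonal]

/-- moments of Gaussian quadratic forms -/
lemma gam_quad {d : ℕ} (C : Matrix (Fin d) (Fin d) ℝ) (hC : C.IsSymm) :
    MemLp (fun z : Fin d → ℝ => dot z (C.mulVec z) - C.trace) 4 (gam d) ∧
    ∫ z, (dot z (C.mulVec z) - C.trace) ∂(gam d) = 0 ∧
    ∫ z, (dot z (C.mulVec z) - C.trace) ^ 2 ∂(gam d) = 2 * frobSq C ∧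
    ∫ z, (dot z (C.mulVec z) - C.trace) ^ 4 ∂(gam d) ≤ K4 * (frobSq C) ^ 2 := by
  obtain ⟨U, l, h1, h2, h3⟩ := spec C hC
  have hf : frobSq C = ∑ k, l k ^ 2 := by rw [h3, frobSq_spec U l h2]
  have ht : C.trace = ∑ k, l k := by rw [h3, trace_spec U l h2]
  have hq : ∀ z, dot z (C.mulVec z) - C.trace =
      ∑ k, l k * ((U.transpose.mulVec z) k ^ 2 - 1) := by
    intro z
    rw [h3, ← Matrix.mulVec_mulVec, ← Matrix.mulVec_mulVec, dot_mulVec, ← h3, ht]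
    simp only [dot, Matrix.mulVec_diagonal]
    rw [← Finset.sum_sub_distrib]
    exact Finset.sum_congr rfl fun i _ => by ring
  have hmp : MeasurePreserving (fun x => U.transpose.mulVec x) (gam d) (gam d) :=
    ⟨measurable_mulVec _, gam_rot U.transpose (by simpa using h2)⟩
  obtain ⟨q1, q2, q3, q4⟩ := gam_diag d l Finset.univ
  simp only [hq, hf]
  have key : ∀ F : (Fin d → ℝ) → ℝ, Measurable F →
      ∫ z, F (U.transpose.mulVec z) ∂(gam d) = ∫ z, F z ∂(gam d) := by
    intro F hF
    have := integral_map (μ := gam d) hmp.measurable.aemeasurable (f := F) (by exact hF.aestronglyMeasurable)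
    rw [← this, hmp.map_eq]
  refine ⟨q1.comp_measurePreserving hmp, ?_, ?_, ?_⟩
  · rw [key (fun z => ∑ k, l k * (z k ^ 2 - 1)) (by fun_prop), q2]
  · rw [key (fun z => (∑ k, l k * (z k ^ 2 - 1)) ^ 2) (by fun_prop), q3]
  · rw [key (fun z => (∑ k, l k * (z k ^ 2 - 1)) ^ 4) (by fun_prop)]; exact q4

end

section
/-- off-diagonal part of the double sum -/
def offD {E : Type*} (K : E → E → ℝ) (m : ℕ) (w : Fin m → E) : ℝ :=
  (∑ i, ∑ j, K (w i) (w j)) - ∑ i, K (w i) (w i)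

lemma offD_succ {E : Type*} (K : E → E → ℝ) (hs : ∀ x y, K x y = K y x) (m : ℕ)
    (w : Fin (m + 1) → E) :
    offD K (m + 1) w = offD K m (fun i => w i.succ) + 2 * ∑ j, K (w 0) (w (Fin.succ j)) := by
  unfold offD
  simp only [Fin.sum_univ_succ, Finset.sum_add_distrib]
  have : ∑ i : Fin m, K (w i.succ) (w 0) = ∑ i : Fin m, K (w 0) (w i.succ) :=
    Finset.sum_congr rfl fun i _ => hs _ _
  rw [this]; ring

lemma pi_sum_sq {E : Type*} [MeasurableSpace E] (P : Measure E) [IsProbabilityMeasure P]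
    (g : E → ℝ) (hg : MemLp g 2 P) (h0 : ∫ x, g x ∂P = 0) (m : ℕ) :
    ∫ w : Fin m → E, (∑ j, g (w j)) ^ 2 ∂(Measure.pi fun _ : Fin m => P) = m * ∫ x, g x ^ 2 ∂P := by
  have h := variance_sum_pi (ι := Fin m) (μ := fun _ => P) (X := fun _ => g) (fun _ => hg)
  have e : (∑ i : Fin m, fun ω : Fin m → E => g (ω i)) = fun ω => ∑ i, g (ω i) := by
    ext ω; simp
  have hM : MemLp (fun ω : Fin m → E => ∑ i, g (ω i)) 2 (Measure.pi fun _ : Fin m => P) :=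
    memLp_finsetSum (μ := Measure.pi fun _ : Fin m => P) Finset.univ
      (fun i _ => memLp_comp_eval P g hg m i)
  have i0 : ∫ w : Fin m → E, (∑ j, g (w j)) ∂(Measure.pi fun _ : Fin m => P) = 0 := by
    rw [integral_finsetSum]
    · simp_rw [integral_comp_eval P g hg.aestronglyMeasurable m]
      simp [h0]
    · intro i _
      exact (memLp_comp_eval P g hg m i).integrable (by norm_num)
  rw [e, variance_eq_integral hM.aestronglyMeasurable.aemeasurable] at h
  simp only [i0, variance_eq_integral hg.aestronglyMeasurable.aemeasurable, h0, sub_zero] at h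
  rw [h]; simp

lemma ustat_bound {E : Type*} [MeasurableSpace E] (P : Measure E) [IsProbabilityMeasure P]
    (K : E → E → ℝ) (hs : ∀ x y, K x y = K y x)
    (hx : ∀ x, MemLp (K x) 2 P) (h0 : ∀ x, ∫ y, K x y ∂P = 0)
    (hK : MemLp (fun p : E × E => K p.1 p.2) 2 (P.prod P)) (m : ℕ) :
    MemLp (offD K m) 2 (Measure.pi fun _ : Fin m => P) ∧
    ∫ w, offD K m w ^ 2 ∂(Measure.pi fun _ : Fin m => P) ≤
      2 * (m : ℝ) ^ 2 * ∫ x, ∫ y, K x y ^ 2 ∂P ∂P := by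
  have hB : 0 ≤ ∫ x, ∫ y, K x y ^ 2 ∂P ∂P :=
    integral_nonneg fun x => integral_nonneg fun y => sq_nonneg _
  set B := ∫ x, ∫ y, K x y ^ 2 ∂P ∂P with hBdef
  induction m with
  | zero =>
    have : offD K 0 = fun _ => 0 := by ext w; simp [offD]
    rw [this]; simp
  | succ m ih =>
    obtain ⟨ih1, ih2⟩ := ih
    have hmp := measurePreserving_piFinSuccAbove (fun _ : Fin (m + 1) => P) 0
    set Pm := Measure.pi fun _ : Fin m => P with hPm
    let G : E × (Fin m → E) → ℝ := fun p => offD K m p.2 + 2 * ∑ j, K p.1 (p.2 j)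
    have eG : offD K (m + 1) = fun w => G (MeasurableEquiv.piFinSuccAbove (fun _ => E) 0 w) := by
      ext w
      rw [offD_succ K hs]
      simp [G, MeasurableEquiv.piFinSuccAbove, Fin.insertNthEquiv]
      rfl
    have mF : MemLp (fun p : E × (Fin m → E) => offD K m p.2) 2 (P.prod Pm) :=
      ih1.comp_measurePreserving measurePreserving_snd
    have mKj : ∀ j : Fin m, MemLp (fun p : E × (Fin m → E) => K p.1 (p.2 j)) 2 (P.prod Pm) := by
      intro j
      exact hK.comp_measurePreserving
        ((MeasurePreserving.id P).prod (measurePreserving_eval (fun _ : Fin m => P) j))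
    have mS : MemLp (fun p : E × (Fin m → E) => ∑ j, K p.1 (p.2 j)) 2 (P.prod Pm) :=
      memLp_finsetSum _ fun j _ => mKj j
    have mG : MemLp G 2 (P.prod Pm) := mF.add (mS.const_mul 2)
    refine ⟨by rw [eG]; exact mG.comp_measurePreserving hmp, ?_⟩
    rw [eG]
    have := hmp.integral_comp' (fun p => G p ^ 2)
    rw [this]
    have iFS : Integrable (fun p : E × (Fin m → E) => offD K m p.2 * ∑ j, K p.1 (p.2 j))
      (P.prod Pm) := mF.integrable_mul mS
    have e2 : (fun p => G p ^ 2) = fun p : E × (Fin m → E) => (offD K m p.2 ^ 2 +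
        4 * (offD K m p.2 * ∑ j, K p.1 (p.2 j))) + 4 * (∑ j, K p.1 (p.2 j)) ^ 2 := by
      ext p; simp only [G]; ring
    have j1 : Integrable (fun p : E × (Fin m → E) => offD K m p.2 ^ 2 +
        4 * (offD K m p.2 * ∑ j, K p.1 (p.2 j))) (P.prod Pm) :=
      mF.integrable_sq.add (iFS.const_mul 4)
    have z1 : ∫ p : E × (Fin m → E), offD K m p.2 * ∑ j, K p.1 (p.2 j) ∂(P.prod Pm) = 0 := by
      rw [integral_prod_symm _ iFS]
      have : ∀ w : Fin m → E, ∫ x, offD K m w * ∑ j, K x (w j) ∂P = 0 := by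
        intro w
        rw [integral_const_mul, integral_finsetSum]
        · have : ∀ j, ∫ x, K x (w j) ∂P = 0 := by
            intro j; simp_rw [hs _ (w j)]; exact h0 _
          simp [this]
        · intro j _
          simp_rw [hs _ (w j)]
          exact (hx _).integrable (by norm_num)
      simp [this]
    have z2 : ∫ p : E × (Fin m → E), offD K m p.2 ^ 2 ∂(P.prod Pm) = ∫ w, offD K m w ^ 2 ∂Pm := by
      have := integral_prod_mul (μ := P) (ν := Pm) (fun _ => (1:ℝ)) (fun w => offD K m w ^ 2)
      simpa using this
    have z3 : ∫ p : E × (Fin m → E), (∑ j, K p.1 (p.2 j)) ^ 2 ∂(P.prod Pm) = m * B := by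
      rw [integral_prod _ mS.integrable_sq]
      simp only
      have : ∀ x, ∫ w : Fin m → E, (∑ j, K x (w j)) ^ 2 ∂Pm = m * ∫ y, K x y ^ 2 ∂P :=
        fun x => pi_sum_sq P (K x) (hx x) (h0 x) m
      simp_rw [this]
      rw [integral_const_mul]
    have := hmp
    change ∫ p, G p ^ 2 ∂(P.prod Pm) ≤ _
    rw [e2, integral_add j1 (mS.integrable_sq.const_mul 4),
      integral_add mF.integrable_sq (iFS.const_mul 4), integral_const_mul, integral_const_mul,
      z1, z2, z3]
    push_cast
    nlinarith
end

section
def dl {d : ℕ} (k l : Fin d) : ℝ := if k = l then 1 else 0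

def Ew {d : ℕ} (s w : Fin d → ℝ) (k l : Fin d) : ℝ := s k * s l * (w k * w l - dl k l)

def Kf {d : ℕ} (s w v : Fin d → ℝ) : ℝ := ∑ k, ∑ l, Ew s w k l * Ew s v k l

def Aw {d : ℕ} (s w : Fin d → ℝ) : Matrix (Fin d) (Fin d) ℝ :=
  Matrix.of fun k l => s k * s l * Ew s w k l

lemma dl_comm {d : ℕ} (k l : Fin d) : dl k l = dl l k := by simp [dl, eq_comm]

lemma dl_sum {d : ℕ} (f : Fin d → Fin d → ℝ) : ∑ k, ∑ l, f k l * dl k l = ∑ k, f k k := by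
  simp [dl]

lemma dl_sq {d : ℕ} (k l : Fin d) : dl k l ^ 2 = dl k l := by
  unfold dl; split_ifs <;> norm_num

lemma Aw_symm {d : ℕ} (s w : Fin d → ℝ) : (Aw s w).IsSymm := by
  ext k l
  simp only [Aw, Ew, Matrix.transpose_apply, Matrix.of_apply, dl_comm l k]
  ring

lemma Kf_symm {d : ℕ} (s w v : Fin d → ℝ) : Kf s w v = Kf s v w := by
  unfold Kf; simp only [mul_comm]

lemma Kf_eq_quad {d : ℕ} (s w v : Fin d → ℝ) :
    Kf s w v = dot v ((Aw s w).mulVec v) - (Aw s w).trace := by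
  have h : (Aw s w).trace = ∑ k, ∑ l, (s k * s l * Ew s w k l) * dl k l := by
    rw [dl_sum]; simp [Matrix.trace, Aw]
  rw [h]
  simp only [Kf, dot, Matrix.mulVec, dotProduct, Finset.mul_sum, ← Finset.sum_sub_distrib, Aw,
    Matrix.of_apply]
  refine Finset.sum_congr rfl fun k _ => Finset.sum_congr rfl fun l _ => ?_
  simp only [Ew]
  ring

lemma frobSq_Aw_le {d : ℕ} (s w : Fin d → ℝ) (hi : ℝ) (h0 : ∀ k, 0 ≤ s k) (hs : ∀ k, s k ≤ hi) :
    frobSq (Aw s w) ≤ hi ^ 4 * Kf s w w := by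
  unfold frobSq Kf
  simp only [Finset.mul_sum]
  refine Finset.sum_le_sum fun k _ => Finset.sum_le_sum fun l _ => ?_
  simp only [Aw, Matrix.of_apply]
  rw [mul_pow, ← pow_two]
  refine mul_le_mul_of_nonneg_right ?_ (sq_nonneg _)
  have h1 : s k * s l ≤ hi * hi := mul_le_mul (hs k) (hs l) (h0 l) ((h0 k).trans (hs k))
  calc (s k * s l) ^ 2 ≤ (hi * hi) ^ 2 :=
        pow_le_pow_left₀ (mul_nonneg (h0 k) (h0 l)) h1 2
    _ = hi ^ 4 := by ring

lemma Kf_diag {d : ℕ} (s w : Fin d → ℝ) :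
    Kf s w w = (∑ k, s k ^ 2 * w k ^ 2) ^ 2 - 2 * ∑ k, s k ^ 4 * w k ^ 2 + ∑ k, s k ^ 4 := by
  have e1 : ∑ k, s k ^ 4 * w k ^ 2 = ∑ k, ∑ l, (s k ^ 2 * s l ^ 2 * (w k * w l)) * dl k l := by
    rw [dl_sum]; exact Finset.sum_congr rfl fun k _ => by ring
  have e2 : ∑ k, s k ^ 4 = ∑ k, ∑ l, (s k ^ 2 * s l ^ 2) * dl k l := by
    rw [dl_sum]; exact Finset.sum_congr rfl fun k _ => by ring
  rw [e1, e2, pow_two (∑ k, s k ^ 2 * w k ^ 2), Finset.sum_mul_sum]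
  simp only [Kf, Finset.mul_sum, ← Finset.sum_sub_distrib, ← Finset.sum_add_distrib]
  refine Finset.sum_congr rfl fun k _ => Finset.sum_congr rfl fun l _ => ?_
  simp only [Ew]
  linear_combination (s k ^ 2 * s l ^ 2) * dl_sq k l

lemma Kf_diag_le {d : ℕ} (s w : Fin d → ℝ) (hi : ℝ) (h0 : ∀ k, 0 ≤ s k) (hs : ∀ k, s k ≤ hi) :
    Kf s w w ≤ hi ^ 4 * ((∑ k, w k ^ 2) ^ 2 + d) := by
  rw [Kf_diag]
  have a1 : 0 ≤ ∑ k, s k ^ 4 * w k ^ 2 := Finset.sum_nonneg fun k _ => by positivity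
  have a2 : ∑ k, s k ^ 4 ≤ hi ^ 4 * d := by
    calc ∑ k, s k ^ 4 ≤ ∑ _k : Fin d, hi ^ 4 :=
          Finset.sum_le_sum fun k _ => pow_le_pow_left₀ (h0 k) (hs k) 4
      _ = hi ^ 4 * d := by simp [mul_comm]
  have a3 : ∑ k, s k ^ 2 * w k ^ 2 ≤ hi ^ 2 * ∑ k, w k ^ 2 := by
    rw [Finset.mul_sum]
    exact Finset.sum_le_sum fun k _ =>
      mul_le_mul_of_nonneg_right (pow_le_pow_left₀ (h0 k) (hs k) 2) (sq_nonneg _)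
  have a4 : (∑ k, s k ^ 2 * w k ^ 2) ^ 2 ≤ (hi ^ 2 * ∑ k, w k ^ 2) ^ 2 :=
    pow_le_pow_left₀ (Finset.sum_nonneg fun k _ => by positivity) a3 2
  nlinarith

lemma Kf_diag_nonneg {d : ℕ} (s w : Fin d → ℝ) : 0 ≤ Kf s w w :=
  Finset.sum_nonneg fun k _ => Finset.sum_nonneg fun l _ => mul_self_nonneg _

lemma R0_int (d : ℕ) : Integrable (fun x : Fin d → ℝ => (∑ k, x k ^ 2) ^ 2) (gam d) ∧
    ∫ x : Fin d → ℝ, (∑ k, x k ^ 2) ^ 2 ∂(gam d) ≤ 4 * d + 2 * (d : ℝ) ^ 2 := by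
  obtain ⟨q1, q2, q3, q4⟩ := gam_diag d (fun _ => 1) Finset.univ
  have q1' : MemLp (fun z : Fin d → ℝ => ∑ k, 1 * (z k ^ 2 - 1)) 2 (gam d) :=
    q1.mono_exponent (by norm_num)
  have hI : Integrable (fun z : Fin d → ℝ => 2 * (∑ k, 1 * (z k ^ 2 - 1)) ^ 2 + 2 * (d : ℝ) ^ 2)
      (gam d) := (q1'.integrable_sq.const_mul 2).add (integrable_const _)
  have hle : ∀ x : Fin d → ℝ, (∑ k, x k ^ 2) ^ 2 ≤
      2 * (∑ k, 1 * (x k ^ 2 - 1)) ^ 2 + 2 * (d : ℝ) ^ 2 := by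
    intro x
    have : ∑ k, 1 * (x k ^ 2 - 1) = (∑ k, x k ^ 2) - d := by simp
    rw [this]
    nlinarith [sq_nonneg ((∑ k, x k ^ 2) - 2 * d)]
  have hI2 : Integrable (fun x : Fin d → ℝ => (∑ k, x k ^ 2) ^ 2) (gam d) := by
    refine hI.mono' ?_ (ae_of_all _ fun x => ?_)
    · exact (show Measurable (fun x : Fin d → ℝ => (∑ k, x k ^ 2) ^ 2) by fun_prop).aestronglyMeasurable
    · rw [Real.norm_eq_abs, abs_of_nonneg (sq_nonneg _)]; exact hle x
  refine ⟨hI2, (integral_mono hI2 hI hle).trans ?_⟩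
  rw [integral_add (q1'.integrable_sq.const_mul 2) (integrable_const _), integral_const_mul, q3]
  simp
  linarith

lemma measurable_Kf {d : ℕ} (s : Fin d → ℝ) :
    Measurable (fun p : (Fin d → ℝ) × (Fin d → ℝ) => Kf s p.1 p.2) := by
  unfold Kf Ew; fun_prop

lemma Kf_fixed {d : ℕ} (s w : Fin d → ℝ) :
    MemLp (Kf s w) 2 (gam d) ∧ ∫ v, Kf s w v ∂(gam d) = 0 ∧
    ∫ v, Kf s w v ^ 2 ∂(gam d) = 2 * frobSq (Aw s w) := by
  obtain ⟨q1, q2, q3, q4⟩ := gam_quad (Aw s w) (Aw_symm s w)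
  have e : Kf s w = fun v => dot v ((Aw s w).mulVec v) - (Aw s w).trace := by
    ext v; exact Kf_eq_quad s w v
  rw [e]
  exact ⟨q1.mono_exponent (by norm_num), q2, q3⟩

lemma Kf_prod {d : ℕ} (hd : 0 < d) (s : Fin d → ℝ) (hi : ℝ) (h0 : ∀ k, 0 ≤ s k) (hs : ∀ k, s k ≤ hi) :
    MemLp (fun p : (Fin d → ℝ) × (Fin d → ℝ) => Kf s p.1 p.2) 2 ((gam d).prod (gam d)) ∧
    ∫ x, ∫ y, Kf s x y ^ 2 ∂(gam d) ∂(gam d) ≤ 14 * hi ^ 8 * (d : ℝ) ^ 2 := by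
  have hle : ∀ x : Fin d → ℝ, 2 * frobSq (Aw s x) ≤ 2 * hi ^ 8 * ((∑ k, x k ^ 2) ^ 2 + d) := by
    intro x
    have a := frobSq_Aw_le s x hi h0 hs
    have b := Kf_diag_le s x hi h0 hs
    have c : 0 ≤ hi ^ 4 := by positivity
    nlinarith [mul_le_mul_of_nonneg_left b c]
  have hI : Integrable (fun x : Fin d → ℝ => 2 * hi ^ 8 * ((∑ k, x k ^ 2) ^ 2 + d)) (gam d) :=
    ((R0_int d).1.add (integrable_const _)).const_mul _
  have hI2 : Integrable (fun x : Fin d → ℝ => 2 * frobSq (Aw s x)) (gam d) := by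
    refine hI.mono' ?_ (ae_of_all _ fun x => ?_)
    · have : Measurable (fun x : Fin d → ℝ => 2 * frobSq (Aw s x)) := by
        unfold frobSq Aw Ew; simp only [Matrix.of_apply]; fun_prop
      exact this.aestronglyMeasurable
    · rw [Real.norm_eq_abs, abs_of_nonneg]
      · exact hle x
      · unfold frobSq; positivity
  have hm := (measurable_Kf s)
  constructor
  · rw [memLp_two_iff_integrable_sq hm.aestronglyMeasurable,
      integrable_prod_iff (hm.pow_const 2).aestronglyMeasurable]
    refine ⟨ae_of_all _ fun x => (Kf_fixed s x).1.integrable_sq, ?_⟩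
    have e : (fun x : Fin d → ℝ => ∫ y, ‖Kf s x y ^ 2‖ ∂(gam d)) = fun x => 2 * frobSq (Aw s x) := by
      ext x
      rw [← (Kf_fixed s x).2.2]
      simp
    simpa only [e] using hI2
  · have e : ∀ x : Fin d → ℝ, ∫ y, Kf s x y ^ 2 ∂(gam d) = 2 * frobSq (Aw s x) :=
      fun x => (Kf_fixed s x).2.2
    simp_rw [e]
    refine (integral_mono hI2 hI hle).trans ?_
    rw [integral_const_mul, integral_add (R0_int d).1 (integrable_const _)]
    have := (R0_int d).2
    have h8 : 0 ≤ hi ^ 8 := by positivity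
    have hd1 : (1 : ℝ) ≤ d := by exact_mod_cast hd
    simp only [integral_const, smul_eq_mul, probReal_univ, one_mul]
    have : ∫ x : Fin d → ℝ, (∑ k, x k ^ 2) ^ 2 ∂(gam d) + d ≤ 7 * (d : ℝ) ^ 2 := by nlinarith
    nlinarith [mul_le_mul_of_nonneg_left this h8]

/-- off-diagonal concentration -/
lemma offD_prob {d : ℕ} (hd : 0 < d) (s : Fin d → ℝ) (hi : ℝ) (h0 : ∀ k, 0 ≤ s k)
    (hs : ∀ k, s k ≤ hi) (m : ℕ) (a : ℝ) (ha : 0 < a) :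
    (Measure.pi fun _ : Fin m => gam d).real {w | a ≤ |offD (Kf s) m w|} ≤
      28 * hi ^ 8 * (d : ℝ) ^ 2 * (m : ℝ) ^ 2 / a ^ 2 := by
  obtain ⟨k1, k2⟩ := Kf_prod hd s hi h0 hs
  obtain ⟨u1, u2⟩ := ustat_bound (gam d) (Kf s) (Kf_symm s) (fun x => (Kf_fixed s x).1)
    (fun x => (Kf_fixed s x).2.1) k1 m
  have := mul_meas_ge_le_integral_of_nonneg (ae_of_all _ fun w => sq_nonneg (offD (Kf s) m w))
    u1.integrable_sq (a ^ 2)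
  have e : {w : Fin m → Fin d → ℝ | a ≤ |offD (Kf s) m w|} = {w | a ^ 2 ≤ offD (Kf s) m w ^ 2} := by
    ext w
    simp only [Set.mem_ofPred_eq]
    rw [sq_le_sq, abs_of_pos ha]
  rw [e, le_div_iff₀ (by positivity), mul_comm]
  refine this.trans (u2.trans ?_)
  have : 0 ≤ 2 * (m : ℝ) ^ 2 := by positivity
  nlinarith [mul_le_mul_of_nonneg_left k2 this]

end

section
/-- remainder dominating the diagonal fluctuation -/
def Yd {d : ℕ} (ε : ℝ) (s w : Fin d → ℝ) : ℝ :=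
  (1 + 1 / ε) * (∑ k, s k ^ 2 * (w k ^ 2 - 1)) ^ 2 + 2 * ∑ k, s k ^ 4 * w k ^ 2 + ∑ k, s k ^ 4

lemma Yd_nonneg {d : ℕ} (ε : ℝ) (hε : 0 < ε) (s w : Fin d → ℝ) : 0 ≤ Yd ε s w := by
  unfold Yd
  have a1 : 0 ≤ ∑ k, s k ^ 4 * w k ^ 2 := Finset.sum_nonneg fun k _ => by positivity
  have a2 : 0 ≤ ∑ k, s k ^ 4 := Finset.sum_nonneg fun k _ => by positivity
  positivity

lemma Kf_diag_close {d : ℕ} (ε : ℝ) (hε : 0 < ε) (s w : Fin d → ℝ) :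
    |Kf s w w - (∑ k, s k ^ 2) ^ 2| ≤ ε * (∑ k, s k ^ 2) ^ 2 + Yd ε s w := by
  rw [Kf_diag]
  unfold Yd
  have a1 : 0 ≤ ∑ k, s k ^ 4 * w k ^ 2 := Finset.sum_nonneg fun k _ => by positivity
  have a2 : 0 ≤ ∑ k, s k ^ 4 := Finset.sum_nonneg fun k _ => by positivity
  have e : ∑ k, s k ^ 2 * w k ^ 2 = (∑ k, s k ^ 2 * (w k ^ 2 - 1)) + ∑ k, s k ^ 2 := by
    rw [← Finset.sum_add_distrib]; exact Finset.sum_congr rfl fun k _ => by ring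
  rw [e]
  set D := ∑ k, s k ^ 2 * (w k ^ 2 - 1)
  set t := ∑ k, s k ^ 2
  have h1 : |2 * t * D| ≤ ε * t ^ 2 + (1 / ε) * D ^ 2 := by
    have key : 0 ≤ (1 / ε) * (ε * |t| - |D|) ^ 2 := by positivity
    have : (1 / ε) * (ε * |t| - |D|) ^ 2 = ε * t ^ 2 + (1 / ε) * D ^ 2 - |2 * t * D| := by
      rw [abs_mul, abs_mul, abs_two, ← sq_abs t, ← sq_abs D]
      field_simp; ring
    linarith
  rw [abs_le] at h1 ⊢
  constructor <;> nlinarith [sq_nonneg D]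

lemma Yd_int {d : ℕ} (ε : ℝ) (s : Fin d → ℝ) :
    Integrable (Yd ε s) (gam d) ∧
    ∫ w, Yd ε s w ∂(gam d) = (5 + 2 / ε) * ∑ k, s k ^ 4 := by
  obtain ⟨q1, q2, q3, q4⟩ := gam_diag d (fun k => s k ^ 2) Finset.univ
  obtain ⟨r1, r2, r3, r4⟩ := gam_diag d (fun k => s k ^ 4) Finset.univ
  have q1' : MemLp (fun z : Fin d → ℝ => ∑ k, s k ^ 2 * (z k ^ 2 - 1)) 2 (gam d) :=
    q1.mono_exponent (by norm_num)
  have i1 := q1'.integrable_sq.const_mul (1 + 1 / ε)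
  have i2 := (r1.integrable (by norm_num)).const_mul 2
  have e : Yd ε s = fun w => (1 + 1 / ε) * (∑ k, s k ^ 2 * (w k ^ 2 - 1)) ^ 2 +
      2 * (∑ k, s k ^ 4 * (w k ^ 2 - 1)) + 3 * ∑ k, s k ^ 4 := by
    ext w
    unfold Yd
    have : ∑ k, s k ^ 4 * w k ^ 2 = (∑ k, s k ^ 4 * (w k ^ 2 - 1)) + ∑ k, s k ^ 4 := by
      rw [← Finset.sum_add_distrib]; exact Finset.sum_congr rfl fun k _ => by ring
    rw [this]; ring
  have i12 : Integrable (fun w : Fin d → ℝ => (1 + 1 / ε) * (∑ k, s k ^ 2 * (w k ^ 2 - 1)) ^ 2 +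
      2 * (∑ k, s k ^ 4 * (w k ^ 2 - 1))) (gam d) := i1.add i2
  rw [e]
  refine ⟨i12.add (integrable_const _), ?_⟩
  rw [integral_add i12 (integrable_const _), integral_add i1 i2, integral_const_mul,
    integral_const_mul, q3, r2]
  simp [← pow_mul]
  ring

lemma Yd_prob {d : ℕ} (ε : ℝ) (hε : 0 < ε) (s : Fin d → ℝ) (m : ℕ) (hm : 0 < m) (a : ℝ)
    (ha : 0 < a) :
    (Measure.pi fun _ : Fin m => gam d).real {w | a ≤ (∑ j, Yd ε s (w j)) / m} ≤
      (5 + 2 / ε) * (∑ k, s k ^ 4) / a := by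
  obtain ⟨h1, h2⟩ := Yd_int ε s
  have hI : Integrable (fun w : Fin m → Fin d → ℝ => (∑ j, Yd ε s (w j)) / m)
      (Measure.pi fun _ : Fin m => gam d) := by
    refine Integrable.div_const (integrable_finsetSum _ fun j _ => ?_) _
    rw [← memLp_one_iff_integrable] at h1 ⊢
    exact memLp_comp_eval (gam d) _ h1 m j
  have := mul_meas_ge_le_integral_of_nonneg (ae_of_all _ fun w => 
    div_nonneg (Finset.sum_nonneg fun j _ => Yd_nonneg ε hε s (w j)) (Nat.cast_nonneg m)) hI a
  rw [pi_integral_mean (gam d) (Yd ε s) h1 m hm, h2] at this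
  rw [le_div_iff₀ ha, mul_comm]
  exact this

def Emat {d : ℕ} (s : Fin d → ℝ) (m : ℕ) (w : Fin m → Fin d → ℝ) : Matrix (Fin d) (Fin d) ℝ :=
  Matrix.of fun k l => (∑ j, Ew s (w j) k l) / m

def Cmat {d : ℕ} (s : Fin d → ℝ) (m : ℕ) (w : Fin m → Fin d → ℝ) : Matrix (Fin d) (Fin d) ℝ :=
  Matrix.of fun k l => Emat s m w k l + s k * (s l - 1) * dl k l

lemma frobSq_Emat {d : ℕ} (s : Fin d → ℝ) (m : ℕ) (w : Fin m → Fin d → ℝ) :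
    frobSq (Emat s m w) = (offD (Kf s) m w + ∑ j, Kf s (w j) (w j)) / (m : ℝ) ^ 2 := by
  unfold offD frobSq Emat Kf
  simp only [Matrix.of_apply, div_pow, ← Finset.sum_div, sub_add_cancel]
  congr 1
  simp_rw [pow_two, Finset.sum_mul_sum]
  have e1 : ∀ k : Fin d, ∑ l, ∑ i : Fin m, ∑ j : Fin m, Ew s (w i) k l * Ew s (w j) k l =
      ∑ i : Fin m, ∑ j : Fin m, ∑ l, Ew s (w i) k l * Ew s (w j) k l := by
    intro k
    rw [Finset.sum_comm]
    refine Finset.sum_congr rfl fun i _ => ?_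
    rw [Finset.sum_comm]
  simp_rw [e1]
  rw [Finset.sum_comm]
  refine Finset.sum_congr rfl fun i _ => ?_
  rw [Finset.sum_comm]

lemma frobSq_add_close {d : ℕ} (E G : Fin d → Fin d → ℝ) (ε : ℝ) (hε : 0 < ε) :
    |frobSq (Matrix.of fun k l => E k l + G k l) - frobSq (Matrix.of E)| ≤
      ε * frobSq (Matrix.of E) + (1 + 1 / ε) * frobSq (Matrix.of G) := by
  unfold frobSq
  simp only [Matrix.of_apply, Finset.mul_sum, ← Finset.sum_sub_distrib, ← Finset.sum_add_distrib]
  refine (Finset.abs_sum_le_sum_abs _ _).trans (Finset.sum_le_sum fun k _ => ?_)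
  refine (Finset.abs_sum_le_sum_abs _ _).trans (Finset.sum_le_sum fun l _ => ?_)
  set e := E k l
  set g := G k l
  have h1 : |2 * e * g| ≤ ε * e ^ 2 + (1 / ε) * g ^ 2 := by
    have key : 0 ≤ (1 / ε) * (ε * |e| - |g|) ^ 2 := by positivity
    have : (1 / ε) * (ε * |e| - |g|) ^ 2 = ε * e ^ 2 + (1 / ε) * g ^ 2 - |2 * e * g| := by
      rw [abs_mul, abs_mul, abs_two, ← sq_abs e, ← sq_abs g]
      field_simp; ring
    linarith
  rw [abs_le] at h1 ⊢
  constructor <;> nlinarith [sq_nonneg g]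

lemma Cmat_det {d : ℕ} (s : Fin d → ℝ) (m : ℕ) (hm : 0 < m) (w : Fin m → Fin d → ℝ) (hi ε : ℝ)
    (hε : 0 < ε) (hε1 : ε ≤ 1) (h0 : ∀ k, 0 ≤ s k) (hs : ∀ k, s k ≤ hi)
    (hG : (1 + 1 / ε) * (m * (hi ^ 2 * ∑ k, (s k - 1) ^ 2)) ≤ ε * (∑ k, s k ^ 2) ^ 2)
    (hO : |offD (Kf s) m w| < m * (ε * (∑ k, s k ^ 2) ^ 2))
    (hY : (∑ j, Yd ε s (w j)) / m < ε * (∑ k, s k ^ 2) ^ 2) :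
    |m * frobSq (Cmat s m w) - (∑ k, s k ^ 2) ^ 2| ≤ 8 * ε * (∑ k, s k ^ 2) ^ 2 := by
  have hmR : (0 : ℝ) < m := by exact_mod_cast hm
  set T := (∑ k, s k ^ 2) ^ 2 with hT
  have hT0 : 0 ≤ T := sq_nonneg _
  have hE : |m * frobSq (Emat s m w) - T| ≤ 3 * ε * T := by
    rw [frobSq_Emat]
    have e : (m : ℝ) * ((offD (Kf s) m w + ∑ j, Kf s (w j) (w j)) / (m : ℝ) ^ 2) - T =
        offD (Kf s) m w / m + (∑ j, (Kf s (w j) (w j) - T)) / m := by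
      rw [Finset.sum_sub_distrib]
      simp
      field_simp
      ring
    rw [e]
    have b1 : |offD (Kf s) m w / m| ≤ ε * T := by
      rw [abs_div, abs_of_pos hmR, div_le_iff₀ hmR]; linarith
    have b2 : |(∑ j, (Kf s (w j) (w j) - T)) / m| ≤ ε * T + (∑ j, Yd ε s (w j)) / m := by
      rw [abs_div, abs_of_pos hmR, div_le_iff₀ hmR]
      calc |∑ j, (Kf s (w j) (w j) - T)| ≤ ∑ j, |Kf s (w j) (w j) - T| :=
            Finset.abs_sum_le_sum_abs _ _
        _ ≤ ∑ j, (ε * T + Yd ε s (w j)) :=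
            Finset.sum_le_sum fun j _ => Kf_diag_close ε hε s (w j)
        _ = (ε * T + (∑ j, Yd ε s (w j)) / m) * m := by
            rw [Finset.sum_add_distrib]; simp; field_simp
    calc _ ≤ |offD (Kf s) m w / m| + |(∑ j, (Kf s (w j) (w j) - T)) / m| := abs_add_le _ _
      _ ≤ 3 * ε * T := by linarith
  have hC := frobSq_add_close (Emat s m w) (fun k l => s k * (s l - 1) * dl k l) ε hε
  have hCe : (Matrix.of fun k l => Emat s m w k l + s k * (s l - 1) * dl k l) = Cmat s m w := rfl
  have hEe : Matrix.of (Emat s m w) = Emat s m w := rfl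
  rw [hCe, hEe] at hC
  have hGF : frobSq (Matrix.of fun k l : Fin d => s k * (s l - 1) * dl k l) ≤
      hi ^ 2 * ∑ k, (s k - 1) ^ 2 := by
    unfold frobSq
    simp only [Matrix.of_apply, mul_pow, dl_sq]
    rw [dl_sum (fun k l => s k ^ 2 * (s l - 1) ^ 2), Finset.mul_sum]
    exact Finset.sum_le_sum fun k _ =>
      mul_le_mul_of_nonneg_right (pow_le_pow_left₀ (h0 k) (hs k) 2) (sq_nonneg _)
  have hC2 : |m * frobSq (Cmat s m w) - m * frobSq (Emat s m w)| ≤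
      ε * (m * frobSq (Emat s m w)) + ε * T := by
    rw [← mul_sub, abs_mul, abs_of_pos hmR]
    have h1e : 0 ≤ 1 + 1 / ε := by positivity
    have := mul_le_mul_of_nonneg_left hC hmR.le
    have h3 := mul_le_mul_of_nonneg_left (mul_le_mul_of_nonneg_left hGF hmR.le) h1e
    nlinarith
  have hE' := abs_le.1 hE
  have : ε * (m * frobSq (Emat s m w)) ≤ 4 * ε * T := by
    have : m * frobSq (Emat s m w) ≤ 4 * T := by nlinarith [hE'.2]
    nlinarith
  have hC2' := abs_le.1 hC2
  rw [abs_le]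
  constructor <;> linarith [hE'.1, hE'.2, hC2'.1, hC2'.2]

end

section
def gmean {d : ℕ} (s w : Fin d → ℝ) : ℝ :=
  (∑ k, s k * (s k - 1) * (w k ^ 2 - 1)) + ∑ k, (s k - 1) ^ 2

lemma gmean_prob {d : ℕ} (s : Fin d → ℝ) (hi L : ℝ) (h0 : ∀ k, 0 ≤ s k) (hs : ∀ k, s k ≤ hi)
    (hL : ∑ k, (s k - 1) ^ 2 ≤ L) (m : ℕ) (hm : 0 < m) (b : ℝ) (hb : 0 < b) :
    (Measure.pi fun _ : Fin m => gam d).real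
      {w | b ≤ |(∑ j, gmean s (w j)) / m - ∑ k, (s k - 1) ^ 2|} ≤ 2 * hi ^ 2 * L / (m * b ^ 2) := by
  obtain ⟨q1, q2, q3, q4⟩ := gam_diag d (fun k => s k * (s k - 1)) Finset.univ
  have q1' : MemLp (fun z : Fin d → ℝ => ∑ k, s k * (s k - 1) * (z k ^ 2 - 1)) 2 (gam d) :=
    q1.mono_exponent (by norm_num)
  have hM : MemLp (gmean s) 2 (gam d) := q1'.add (memLp_const _)
  have hI : ∫ w, gmean s w ∂(gam d) = ∑ k, (s k - 1) ^ 2 := by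
    unfold gmean
    rw [integral_add (q1.integrable (by norm_num)) (integrable_const _), q2]
    simp
  have hV : Var[gmean s; gam d] ≤ 2 * hi ^ 2 * L := by
    rw [variance_eq_integral hM.aestronglyMeasurable.aemeasurable, hI]
    simp only [gmean, add_sub_cancel_right]
    rw [q3]
    have : ∑ k, (s k * (s k - 1)) ^ 2 ≤ hi ^ 2 * ∑ k, (s k - 1) ^ 2 := by
      rw [Finset.mul_sum]
      refine Finset.sum_le_sum fun k _ => ?_
      rw [mul_pow]
      exact mul_le_mul_of_nonneg_right (pow_le_pow_left₀ (h0 k) (hs k) 2) (sq_nonneg _)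
    nlinarith [mul_le_mul_of_nonneg_left hL (sq_nonneg hi)]
  have := pi_cheb (gam d) (gmean s) hM m hm b hb
  rw [hI] at this
  refine this.trans ?_
  have hmR : (0 : ℝ) < m := by exact_mod_cast hm
  gcongr

set_option maxHeartbeats 2000000 in
lemma second_half (lo hi L ρ c b η : ℝ) (hlo : 0 < lo) (hL0 : 0 ≤ L) (hρ : 0 < ρ)
    (hc : 0 < c) (hc1 : c ≤ 1) (hb : 0 < b) (hη : 0 < η) :
    ∃ N : ℕ, ∀ d m : ℕ, N ≤ d → N ≤ m → (m : ℝ) ≤ ρ * d → ∀ s : Fin d → ℝ,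
      (∀ k, lo ≤ s k) → (∀ k, s k ≤ hi) → ∑ k, (s k - 1) ^ 2 ≤ L →
      (Measure.pi fun _ : Fin m => gam d).real
        {w | ¬ (|m * frobSq (Cmat s m w) - (∑ k, s k ^ 2) ^ 2| ≤ c * (∑ k, s k ^ 2) ^ 2 ∧
          |(∑ j, gmean s (w j)) / m - ∑ k, (s k - 1) ^ 2| < b)} ≤ η := by
  set ε := c / 8 with hεd
  have hε : 0 < ε := by positivity
  have hε1 : ε ≤ 1 := by rw [hεd]; linarith
  set A1 := 28 * hi ^ 8 / (ε ^ 2 * lo ^ 8) with hA1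
  set A2 := (5 + 2 / ε) * hi ^ 4 / (ε * lo ^ 4) with hA2
  set A3 := 2 * hi ^ 2 * L / b ^ 2 with hA3
  set A4 := (1 + 1 / ε) * (ρ * (hi ^ 2 * L)) / (ε * lo ^ 4) with hA4
  obtain ⟨N, hN⟩ := exists_nat_ge (max (max 1 A4) (max (3 * A1 / η) (max (3 * A2 / η) (3 * A3 / η))))
  refine ⟨N, fun d m hd hm hmd s hs1 hs2 hF => ?_⟩
  have hN1 : 1 ≤ (N : ℝ) := ((le_max_left _ _).trans (le_max_left _ _)).trans hN
  have hNA4 : A4 ≤ (N : ℝ) := ((le_max_right _ _).trans (le_max_left _ _)).trans hN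
  have hNA1 : 3 * A1 / η ≤ (N : ℝ) := ((le_max_left _ _).trans (le_max_right _ _)).trans hN
  have hNA2 : 3 * A2 / η ≤ (N : ℝ) :=
    (((le_max_left _ _).trans (le_max_right _ _)).trans (le_max_right _ _)).trans hN
  have hNA3 : 3 * A3 / η ≤ (N : ℝ) :=
    (((le_max_right _ _).trans (le_max_right _ _)).trans (le_max_right _ _)).trans hN
  have hdN : (N : ℝ) ≤ d := by exact_mod_cast hd
  have hmN : (N : ℝ) ≤ m := by exact_mod_cast hm
  have hdR : (1 : ℝ) ≤ d := hN1.trans hdN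
  have hmR : (1 : ℝ) ≤ m := hN1.trans hmN
  have hd0 : 0 < d := by exact_mod_cast (show (0:ℝ) < d by linarith)
  have hm0 : 0 < m := by exact_mod_cast (show (0:ℝ) < m by linarith)
  have h0 : ∀ k, 0 ≤ s k := fun k => hlo.le.trans (hs1 k)
  have hd0' : (0:ℝ) < d := by linarith
  have hm0' : (0:ℝ) < m := by linarith
  have ht : lo ^ 2 * d ≤ ∑ k, s k ^ 2 := by
    calc lo ^ 2 * d = ∑ _k : Fin d, lo ^ 2 := by simp [mul_comm]
      _ ≤ _ := Finset.sum_le_sum fun k _ => pow_le_pow_left₀ hlo.le (hs1 k) 2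
  have hT : lo ^ 4 * (d : ℝ) ^ 2 ≤ (∑ k, s k ^ 2) ^ 2 := by
    calc lo ^ 4 * (d : ℝ) ^ 2 = (lo ^ 2 * d) ^ 2 := by ring
      _ ≤ _ := pow_le_pow_left₀ (by positivity) ht 2
  set T := (∑ k, s k ^ 2) ^ 2 with hTd
  have hT0 : 0 < T := lt_of_lt_of_le (by positivity) hT
  have h4 : ∑ k, s k ^ 4 ≤ hi ^ 4 * d := by
    calc ∑ k, s k ^ 4 ≤ ∑ _k : Fin d, hi ^ 4 :=
          Finset.sum_le_sum fun k _ => pow_le_pow_left₀ (h0 k) (hs2 k) 4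
      _ = hi ^ 4 * d := by simp [mul_comm]
  have hG : (1 + 1 / ε) * (m * (hi ^ 2 * ∑ k, (s k - 1) ^ 2)) ≤ ε * T := by
    have h1 : A4 ≤ d := hNA4.trans hdN
    rw [hA4, div_le_iff₀ (by positivity)] at h1
    have hF0 : 0 ≤ ∑ k, (s k - 1) ^ 2 := Finset.sum_nonneg fun k _ => sq_nonneg _
    calc (1 + 1 / ε) * (m * (hi ^ 2 * ∑ k, (s k - 1) ^ 2)) 
        ≤ (1 + 1 / ε) * ((ρ * d) * (hi ^ 2 * L)) := by gcongr
      _ = ((1 + 1 / ε) * (ρ * (hi ^ 2 * L))) * d := by ring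
      _ ≤ (d * (ε * lo ^ 4)) * d := by gcongr
      _ = ε * (lo ^ 4 * (d : ℝ) ^ 2) := by ring
      _ ≤ ε * T := by gcongr
  have pO := offD_prob hd0 s hi h0 hs2 m (m * (ε * T)) (by positivity)
  have pY := Yd_prob ε hε s m hm0 (ε * T) (by positivity)
  have pG := gmean_prob s hi L h0 hs2 hF m hm0 b hb
  have bO : 28 * hi ^ 8 * (d : ℝ) ^ 2 * (m : ℝ) ^ 2 / (m * (ε * T)) ^ 2 ≤ η / 3 := by
    calc _ = 28 * hi ^ 8 * (d : ℝ) ^ 2 / (ε ^ 2 * T ^ 2) := by field_simp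
      _ ≤ 28 * hi ^ 8 * (d : ℝ) ^ 2 / (ε ^ 2 * (lo ^ 4 * (d : ℝ) ^ 2) ^ 2) := by gcongr
      _ = A1 / (d : ℝ) ^ 2 := by rw [hA1]; field_simp
      _ ≤ A1 / (d : ℝ) := by
          have : 0 ≤ A1 := by rw [hA1]; positivity
          gcongr; nlinarith
      _ ≤ η / 3 := by
          have := hNA1.trans hdN
          rw [div_le_iff₀ hη] at this
          rw [div_le_iff₀ hd0']; nlinarith
  have bY : (5 + 2 / ε) * (∑ k, s k ^ 4) / (ε * T) ≤ η / 3 := by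
    have h50 : 0 ≤ 5 + 2 / ε := by positivity
    calc _ ≤ (5 + 2 / ε) * (hi ^ 4 * d) / (ε * (lo ^ 4 * (d : ℝ) ^ 2)) := by gcongr
      _ = A2 / (d : ℝ) := by rw [hA2]; field_simp
      _ ≤ η / 3 := by
          have := hNA2.trans hdN
          rw [div_le_iff₀ hη] at this
          rw [div_le_iff₀ hd0']; nlinarith
  have bG : 2 * hi ^ 2 * L / (m * b ^ 2) ≤ η / 3 := by
    calc _ = A3 / (m : ℝ) := by rw [hA3]; field_simp
      _ ≤ η / 3 := by
          have := hNA3.trans hmN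
          rw [div_le_iff₀ hη] at this
          rw [div_le_iff₀ hm0']; nlinarith
  set S1 := {w : Fin m → Fin d → ℝ | m * (ε * T) ≤ |offD (Kf s) m w|} with hS1
  set S2 := {w : Fin m → Fin d → ℝ | ε * T ≤ (∑ j, Yd ε s (w j)) / m} with hS2
  set S3 := {w : Fin m → Fin d → ℝ | b ≤ |(∑ j, gmean s (w j)) / m - ∑ k, (s k - 1) ^ 2|} with hS3
  have hsub : {w | ¬ (|m * frobSq (Cmat s m w) - T| ≤ c * T ∧
          |(∑ j, gmean s (w j)) / m - ∑ k, (s k - 1) ^ 2| < b)} ⊆ S1 ∪ S2 ∪ S3 := by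
    intro w hw
    by_contra hcon
    simp only [Set.mem_union, not_or, hS1, hS2, hS3, Set.mem_ofPred_eq, not_le] at hcon
    obtain ⟨⟨g1, g2⟩, g3⟩ := hcon
    apply hw
    refine ⟨?_, g3⟩
    have := Cmat_det s m hm0 w hi ε hε hε1 h0 hs2 hG g1 g2
    have e8 : 8 * ε = c := by rw [hεd]; ring
    rwa [e8] at this
  calc _ ≤ (Measure.pi fun _ : Fin m => gam d).real (S1 ∪ S2 ∪ S3) := measureReal_mono hsub
    _ ≤ (Measure.pi fun _ : Fin m => gam d).real (S1 ∪ S2) +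
        (Measure.pi fun _ : Fin m => gam d).real S3 := measureReal_union_le _ _
    _ ≤ (Measure.pi fun _ : Fin m => gam d).real S1 + (Measure.pi fun _ : Fin m => gam d).real S2 +
        (Measure.pi fun _ : Fin m => gam d).real S3 := by gcongr; exact measureReal_union_le _ _
    _ ≤ η := by linarith

end

section
lemma append_map {E : Type*} [MeasurableSpace E] (P : Measure E) [IsProbabilityMeasure P]
    (m₁ m₂ : ℕ) (S : Set (Fin (m₁ + m₂) → E)) (hS : MeasurableSet S) :
    (Measure.pi fun _ : Fin (m₁ + m₂) => P).real S =
      ((Measure.pi fun _ : Fin m₁ => P).prod (Measure.pi fun _ : Fin m₂ => P)).real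
        {p | Fin.append p.1 p.2 ∈ S} := by
  have hm : Measurable (fun p : (Fin m₁ → E) × (Fin m₂ → E) => (Fin.append p.1 p.2 : Fin (m₁ + m₂) → E)) := by
    rw [measurable_pi_iff]
    intro i
    refine Fin.addCases (fun i => ?_) (fun i => ?_) i
    · simp only [Fin.append_left]; fun_prop
    · simp only [Fin.append_right]; fun_prop
  have : (Measure.pi fun _ : Fin (m₁ + m₂) => P) =
      ((Measure.pi fun _ : Fin m₁ => P).prod (Measure.pi fun _ : Fin m₂ => P)).map
        (fun p => Fin.append p.1 p.2) := by
    refine Measure.pi_eq fun s hs => ?_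
    rw [Measure.map_apply hm (MeasurableSet.univ_pi hs)]
    have e : (fun p : (Fin m₁ → E) × (Fin m₂ → E) => (Fin.append p.1 p.2 : Fin (m₁ + m₂) → E)) ⁻¹'
        (Set.univ.pi s) = (Set.univ.pi fun i => s (Fin.castAdd m₂ i)) ×ˢ
          (Set.univ.pi fun i => s (Fin.natAdd m₁ i)) := by
      ext p
      simp only [Set.mem_preimage, Set.mem_pi, Set.mem_univ, true_imp_iff, Set.mem_prod]
      constructor
      · intro h
        exact ⟨fun i => by simpa using h (Fin.castAdd m₂ i), fun i => by simpa using h (Fin.natAdd m₁ i)⟩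
      · rintro ⟨h1, h2⟩ i
        refine Fin.addCases (fun i => ?_) (fun i => ?_) i
        · simpa using h1 i
        · simpa using h2 i
    rw [e, Measure.prod_prod, Measure.pi_pi, Measure.pi_pi, Fin.prod_univ_add]
  rw [this, map_measureReal_apply hm hS]
  rfl

lemma mix {A B : Type*} [MeasurableSpace A] [MeasurableSpace B] (μ : Measure A) (ν : Measure B)
    [IsProbabilityMeasure μ] [IsProbabilityMeasure ν] (S : Set (A × B)) (hS : MeasurableSet S)
    (Bad : Set B) (c η : ℝ) (hc0 : 0 ≤ c) (hc1 : c ≤ 1) (hη : 0 ≤ η)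
    (hB : ν.real Bad ≤ η)
    (h : ∀ w, w ∉ Bad → |μ.real {u | (u, w) ∈ S} - c| ≤ η) :
    |(μ.prod ν).real S - c| ≤ 2 * η := by
  have hm : Measurable fun w => μ.real {u | (u, w) ∈ S} :=
    (measurable_measure_prodMk_right (μ := μ) hS).ennreal_toReal
  have hInt : Integrable (fun w => μ.real {u | (u, w) ∈ S}) ν := by
    refine Integrable.of_bound hm.aestronglyMeasurable 1 (ae_of_all _ fun w => ?_)
    rw [Real.norm_eq_abs, abs_of_nonneg measureReal_nonneg]
    exact measureReal_le_one
  have e : (μ.prod ν).real S = ∫ w, μ.real {u | (u, w) ∈ S} ∂ν := by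
    rw [measureReal_def, Measure.prod_apply_symm hS]
    rw [← integral_toReal]
    · rfl
    · exact (measurable_measure_prodMk_right (μ := μ) hS).aemeasurable
    · exact ae_of_all _ fun w => measure_lt_top _ _
  rw [e]
  have e2 : ∫ w, μ.real {u | (u, w) ∈ S} ∂ν - c = ∫ w, (μ.real {u | (u, w) ∈ S} - c) ∂ν := by
    rw [integral_sub hInt (integrable_const _)]; simp
  rw [e2]
  set B' := toMeasurable ν Bad with hB'
  have hB'm : MeasurableSet B' := measurableSet_toMeasurable _ _
  have hB'r : ν.real B' ≤ η := by
    rw [measureReal_def, measure_toMeasurable]; exact hB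
  have hi2 : Integrable (fun w => η + B'.indicator (fun _ => (1:ℝ)) w) ν :=
    (integrable_const _).add ((integrable_const _).indicator hB'm)
  calc |∫ w, (μ.real {u | (u, w) ∈ S} - c) ∂ν| ≤ ∫ w, |μ.real {u | (u, w) ∈ S} - c| ∂ν :=
        abs_integral_le_integral_abs
    _ ≤ ∫ w, (η + B'.indicator (fun _ => (1:ℝ)) w) ∂ν := by
        refine integral_mono (hInt.sub (integrable_const _)).abs hi2 fun w => ?_
        by_cases hw : w ∈ B'
        · simp only [Set.indicator_of_mem hw]
          have a1 : 0 ≤ μ.real {u | (u, w) ∈ S} := measureReal_nonneg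
          have a2 : μ.real {u | (u, w) ∈ S} ≤ 1 := measureReal_le_one
          rw [abs_le]; constructor <;> linarith
        · simp only [Set.indicator_of_notMem hw, add_zero]
          exact h w fun hw' => hw (subset_toMeasurable _ _ hw')
    _ = η + ν.real B' := by
        rw [integral_add (integrable_const _) ((integrable_const _).indicator hB'm),
          integral_indicator hB'm]
        simp
    _ ≤ 2 * η := by linarith

def Hs {d : ℕ} (s z w : Fin d → ℝ) : ℝ :=
  (∑ k, s k * z k * w k) ^ 2 - ∑ k, s k * z k ^ 2 - ∑ k, s k * w k ^ 2 + d

lemma Cmat_symm {d : ℕ} (s : Fin d → ℝ) (m : ℕ) (w : Fin m → Fin d → ℝ) : (Cmat s m w).IsSymm := by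
  ext k l
  simp only [Cmat, Emat, Matrix.transpose_apply, Matrix.of_apply]
  congr 1
  · congr 1
    refine Finset.sum_congr rfl fun j _ => ?_
    simp only [Ew, dl_comm l k]; ring
  · unfold dl
    by_cases h : k = l
    · subst h; rfl
    · rw [if_neg h, if_neg (fun h' => h h'.symm)]; simp

lemma Hs_eq {d : ℕ} (s z w : Fin d → ℝ) :
    Hs s z w = (∑ k, ∑ l, (Ew s w k l + s k * (s l - 1) * dl k l) * (z k * z l - dl k l))
      + gmean s w := by
  have e1 : (∑ k, s k * z k * w k) ^ 2 = ∑ k, ∑ l, (s k * s l * w k * w l) * (z k * z l) := by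
    rw [pow_two, Finset.sum_mul_sum]
    exact Finset.sum_congr rfl fun k _ => Finset.sum_congr rfl fun l _ => by ring
  have e2 : ∑ k, s k * z k ^ 2 = ∑ k, ∑ l, (s k * z k * z l) * dl k l := by
    rw [dl_sum]; exact Finset.sum_congr rfl fun k _ => by ring
  have e3 : ∑ k, ∑ l, (Ew s w k l + s k * (s l - 1) * dl k l) * (z k * z l - dl k l) =
     ∑ k, ∑ l, ((s k * s l * w k * w l) * (z k * z l) - (s k * z k * z l) * dl k l
      - (s k * s l * w k * w l - s k) * dl k l) := by
    refine Finset.sum_congr rfl fun k _ => Finset.sum_congr rfl fun l _ => ?_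
    unfold Ew
    by_cases h : k = l
    · subst h; simp [dl]; ring
    · simp only [dl, if_neg h]; ring
  rw [e3]
  simp only [Finset.sum_sub_distrib]
  rw [dl_sum (fun k l => s k * s l * w k * w l - s k), ← e1, ← e2]
  have e4 : ∑ k, (s k * s k * w k * w k - s k) = gmean s w + ∑ k, s k * w k ^ 2 - d := by
    unfold gmean
    have : (d : ℝ) = ∑ _k : Fin d, (1:ℝ) := by simp
    rw [this, ← Finset.sum_add_distrib, ← Finset.sum_add_distrib, ← Finset.sum_sub_distrib]
    exact Finset.sum_congr rfl fun k _ => by ring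
  rw [e4]
  unfold Hs; ring

lemma Hs_mean_eq {d : ℕ} (s : Fin d → ℝ) (m : ℕ) (hm : 0 < m) (w : Fin m → Fin d → ℝ)
    (z : Fin d → ℝ) :
    (∑ j, Hs s z (w j)) / m = (dot z ((Cmat s m w).mulVec z) - (Cmat s m w).trace)
      + (∑ j, gmean s (w j)) / m := by
  have hmR : (m : ℝ) ≠ 0 := by positivity
  have h1 : dot z ((Cmat s m w).mulVec z) - (Cmat s m w).trace =
      ∑ k, ∑ l, Cmat s m w k l * (z k * z l - dl k l) := by
    have h : (Cmat s m w).trace = ∑ k, ∑ l, Cmat s m w k l * dl k l := by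
      rw [dl_sum (fun k l => Cmat s m w k l)]; simp [Matrix.trace]
    rw [h]
    simp only [dot, Matrix.mulVec, dotProduct, Finset.mul_sum, ← Finset.sum_sub_distrib]
    exact Finset.sum_congr rfl fun k _ => Finset.sum_congr rfl fun l _ => by ring
  have h2 : ∀ k l, Cmat s m w k l = (∑ j, (Ew s (w j) k l + s k * (s l - 1) * dl k l)) / m := by
    intro k l
    rw [Finset.sum_add_distrib]
    simp [Cmat, Emat]
    field_simp
  rw [h1]
  simp only [Hs_eq, Finset.sum_add_distrib, add_div]
  congr 1
  rw [div_eq_iff hmR, Finset.sum_mul, Finset.sum_comm]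
  refine Finset.sum_congr rfl fun k _ => ?_
  rw [Finset.sum_mul, Finset.sum_comm]
  refine Finset.sum_congr rfl fun l _ => ?_
  rw [h2, ← Finset.sum_mul]
  field_simp

lemma ratio_close (A A' μ F q L A0 b c e : ℝ) (hA : |A| ≤ A0) (hF0 : 0 ≤ F) (hFL : F ≤ L)
    (hq0 : 0 ≤ q) (hq : |q ^ 2 - 1| ≤ c) (hc : c ≤ 1 / 2) (hμ : |μ - F| ≤ b) (hb : b ≤ 1)
    (he : |A - A'| ≤ e) :
    |A * μ / q - A' * F| ≤ A0 * (L + 1) * (2 * c) + A0 * b + e * L := by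
  have hq' := abs_le.1 hq
  have hc0 : 0 ≤ c := (abs_nonneg _).trans hq
  have hqh : 1 / 2 ≤ q := by nlinarith
  have hqpos : 0 < q := by linarith
  have hA0 : 0 ≤ A0 := (abs_nonneg _).trans hA
  have hb0 : 0 ≤ b := (abs_nonneg _).trans hμ
  have he0 : 0 ≤ e := (abs_nonneg _).trans he
  have hq1 : |1 / q - 1| ≤ 2 * c := by
    have : 1 / q - 1 = (1 - q ^ 2) / (q * (1 + q)) := by field_simp; ring
    rw [this, abs_div, abs_of_pos (show 0 < q * (1 + q) by positivity), div_le_iff₀ (by positivity),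
      abs_sub_comm]
    nlinarith
  have hμL : |μ| ≤ L + 1 := by
    have := abs_le.1 hμ
    rw [abs_le]; constructor <;> linarith
  have e1 : A * μ / q - A' * F = A * μ * (1 / q - 1) + A * (μ - F) + (A - A') * F := by
    field_simp; ring
  rw [e1]
  calc _ ≤ |A * μ * (1 / q - 1)| + |A * (μ - F)| + |(A - A') * F| := abs_add_three _ _ _
    _ = |A| * |μ| * |1 / q - 1| + |A| * |μ - F| + |A - A'| * F := by
        rw [abs_mul, abs_mul, abs_mul, abs_mul, abs_of_nonneg hF0]
    _ ≤ _ := by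
        have hL1 : 0 ≤ L + 1 := by linarith
        have := mul_nonneg hA0 hL1
        gcongr

end

section
lemma measurable_studentized {A : Type*} [MeasurableSpace A] (m : ℕ) (f : A → Fin m → ℝ)
    (hf : ∀ i, Measurable fun a => f a i) : Measurable fun a => studentized m (f a) := by
  unfold studentized
  have h1 : Measurable fun a => (∑ i, f a i) / (m:ℝ) :=
    (Finset.measurable_sum _ fun i _ => hf i).div_const _
  have h2 : Measurable fun a => (∑ i, (f a i - (∑ j, f a j) / m) ^ 2) / (m : ℝ) :=
    (Finset.measurable_sum _ fun i _ => ((hf i).sub h1).pow_const 2).div_const _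
  exact (h1.const_mul _).div h2.sqrt

lemma measurable_Hs {A : Type*} [MeasurableSpace A] {d : ℕ} (s : Fin d → ℝ) (f g : A → Fin d → ℝ)
    (hf : Measurable f) (hg : Measurable g) : Measurable fun a => Hs s (f a) (g a) := by
  unfold Hs
  have hf' : ∀ k, Measurable fun a => f a k := fun k => (measurable_pi_apply k).comp hf
  have hg' : ∀ k, Measurable fun a => g a k := fun k => (measurable_pi_apply k).comp hg
  fun_prop

lemma integrable_four {A : Type*} [MeasurableSpace A] (μ : Measure A) (f : A → ℝ)
    (hf : MemLp f 4 μ) : Integrable (fun x => f x ^ 4) μ := by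
  have := hf.integrable_norm_pow (p := 4) (by norm_num)
  refine this.congr (ae_of_all _ fun x => ?_)
  simp only [Real.norm_eq_abs]
  exact (show Even 4 by decide).pow_abs _

lemma power_fin (lo hi L ρ A0 z R η : ℝ) (hlo : 0 < lo) (hL0 : 0 ≤ L) (hρ : 0 < ρ)
    (hA0 : 0 ≤ A0) (hη : 0 < η) :
    ∃ N : ℕ, ∃ e : ℝ, 0 < e ∧ ∀ d m₁ m₂ : ℕ, N ≤ d → N ≤ m₁ → N ≤ m₂ → (m₂ : ℝ) ≤ ρ * d →
      ∀ s : Fin d → ℝ, (∀ k, lo ≤ s k) → (∀ k, s k ≤ hi) → ∑ k, (s k - 1) ^ 2 ≤ L →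
      ∀ A A' : ℝ, A = √m₁ * √m₂ / (√2 * ∑ k, s k ^ 2) → |A| ≤ A0 → |A - A'| ≤ e →
      |A' * ∑ k, (s k - 1) ^ 2| ≤ R →
      |(Measure.pi fun _ : Fin (m₁ + m₂) => gam d).real
        {ω | z < studentized m₁ (fun i =>
          (∑ j : Fin m₂, Hs s (ω (Fin.castAdd m₂ i)) (ω (Fin.natAdd m₁ j))) / m₂)}
        - Φ (A' * ∑ k, (s k - 1) ^ 2 - z)| ≤ 2 * η := by
  obtain ⟨N1, ε, hε, hst⟩ := student_unif (K4 / 4) z R η hη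
  set c : ℝ := min (1/2) (ε / (6 * (A0 * (L + 1) + 1))) with hc
  set b : ℝ := min 1 (ε / (3 * (A0 + 1))) with hb
  set e : ℝ := ε / (3 * (L + 1)) with he
  have hL1 : 0 < L + 1 := by linarith
  have hAL : 0 ≤ A0 * (L + 1) := by positivity
  have hcpos : 0 < c := lt_min (by norm_num) (by positivity)
  have hbpos : 0 < b := lt_min (by norm_num) (by positivity)
  have hepos : 0 < e := by positivity
  have htot : A0 * (L + 1) * (2 * c) + A0 * b + e * L ≤ ε := by
    have h1 : (A0 * (L + 1) + 1) * c ≤ ε / 6 := by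
      calc _ ≤ (A0 * (L + 1) + 1) * (ε / (6 * (A0 * (L + 1) + 1))) := by
            gcongr; exact min_le_right _ _
        _ = ε / 6 := by field_simp
    have h2 : (A0 + 1) * b ≤ ε / 3 := by
      calc _ ≤ (A0 + 1) * (ε / (3 * (A0 + 1))) := by
            gcongr; exact min_le_right _ _
        _ = ε / 3 := by field_simp
    have h3 : e * (L + 1) = ε / 3 := by rw [he]; field_simp
    nlinarith
  obtain ⟨N2, hsec⟩ := second_half lo hi L ρ c b η hlo hL0 hρ hcpos
    ((min_le_left _ _).trans (by norm_num)) hbpos hη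
  refine ⟨max (max N1 N2) 1, e, hepos, fun d m₁ m₂ hdN hm1N hm2N hmd s hs1 hs2 hsL A A' hA hA0' hAA' hR => ?_⟩
  have hd1 : 0 < d := (le_max_right _ _).trans hdN
  have hm1 : 0 < m₁ := (le_max_right _ _).trans hm1N
  have hm2 : 0 < m₂ := (le_max_right _ _).trans hm2N
  have hN2d : N2 ≤ d := ((le_max_right _ _).trans (le_max_left _ _)).trans hdN
  have hN2m : N2 ≤ m₂ := ((le_max_right _ _).trans (le_max_left _ _)).trans hm2N
  have hN1m : N1 ≤ m₁ := ((le_max_left _ _).trans (le_max_left _ _)).trans hm1N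
  have hbad := hsec d m₂ hN2d hN2m hmd s hs1 hs2 hsL
  set t := ∑ k, s k ^ 2 with ht
  set F := ∑ k, (s k - 1) ^ 2 with hF
  have htpos : 0 < t := by
    have : Nonempty (Fin d) := ⟨⟨0, hd1⟩⟩
    refine Finset.sum_pos (fun k _ => ?_) Finset.univ_nonempty
    have := hlo.trans_le (hs1 k)
    positivity
  have hF0 : 0 ≤ F := Finset.sum_nonneg fun k _ => sq_nonneg _
  have hSm : MeasurableSet {ω : Fin (m₁ + m₂) → Fin d → ℝ | z < studentized m₁ (fun i =>
          (∑ j : Fin m₂, Hs s (ω (Fin.castAdd m₂ i)) (ω (Fin.natAdd m₁ j))) / m₂)} := by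
    refine measurableSet_lt measurable_const (measurable_studentized _ _ fun i => ?_)
    exact (Finset.measurable_sum _ fun j _ => measurable_Hs s _ _ (measurable_pi_apply _)
      (measurable_pi_apply _)).div_const _
  rw [append_map _ _ _ _ hSm]
  have hcd0 : 0 ≤ Φ (A' * F - z) := by rw [Phi_eq_real]; exact measureReal_nonneg
  have hcd1 : Φ (A' * F - z) ≤ 1 := by rw [Phi_eq_real]; exact measureReal_le_one
  refine mix _ _ _ ?_ _ _ η hcd0 hcd1 hη.le hbad ?_
  · refine measurableSet_preimage (f := fun p : (Fin m₁ → Fin d → ℝ) × (Fin m₂ → Fin d → ℝ) => (Fin.append p.1 p.2 : Fin (m₁ + m₂) → Fin d → ℝ)) ?_ hSm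
    rw [measurable_pi_iff]
    intro i
    refine Fin.addCases (fun i => ?_) (fun i => ?_) i
    · simp only [Fin.append_left]; fun_prop
    · simp only [Fin.append_right]; fun_prop
  · intro w hw
    simp only [Set.mem_ofPred_eq, not_not] at hw
    obtain ⟨hw1, hw2⟩ := hw
    simp only [Set.mem_ofPred_eq, Fin.append_left, Fin.append_right]
    set Q := frobSq (Cmat s m₂ w) with hQ
    set μ := (∑ j, gmean s (w j)) / (m₂:ℝ) with hμ
    have hm2R : (0:ℝ) < m₂ := by exact_mod_cast hm2
    have hQpos : 0 < Q := by
      have h1 := (abs_le.1 hw1).1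
      have : c ≤ 1/2 := min_le_left _ _
      have h2 : 0 < m₂ * Q := by nlinarith [sq_pos_of_pos htpos]
      exact (pos_iff_pos_of_mul_pos h2).1 hm2R
    obtain ⟨g1, g2, g3, g4⟩ := gam_quad (Cmat s m₂ w) (Cmat_symm s m₂ w)
    have hfm : ∀ x, (∑ j, Hs s x (w j)) / (m₂:ℝ) - μ =
        dot x ((Cmat s m₂ w).mulVec x) - (Cmat s m₂ w).trace := by
      intro x; rw [Hs_mean_eq s m₂ hm2 w x]; ring
    have hσ : (√(2 * Q)) ^ 2 = 2 * Q := Real.sq_sqrt (by positivity)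
    refine hst m₁ hN1m (Fin d → ℝ) _ (gam d) inferInstance
      (fun x => (∑ j, Hs s x (w j)) / (m₂:ℝ)) μ (√(2 * Q)) ?_ ?_ ?_ ?_ ?_ ?_ (A' * F) hR ?_
    · exact (Finset.measurable_sum _ fun j _ => measurable_Hs s _ _ measurable_id
        measurable_const).div_const _
    · positivity
    · simp only [hfm]; exact integrable_four _ _ g1
    · simp only [hfm]; exact g2
    · simp only [hfm]; rw [g3, hσ]
    · simp only [hfm]
      refine g4.trans (le_of_eq ?_)
      have : (√(2 * Q)) ^ 4 = (2 * Q) ^ 2 := by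
        rw [show (√(2 * Q)) ^ 4 = ((√(2 * Q)) ^ 2) ^ 2 by ring, hσ]
      rw [this]; ring
    · set q := √(m₂ * Q) / t with hq
      have hqpos : 0 < q := by positivity
      have hq2 : q ^ 2 = m₂ * Q / t ^ 2 := by
        rw [hq, div_pow, Real.sq_sqrt (by positivity)]
      have e1 : √m₁ * μ / √(2 * Q) = A * μ / q := by
        rw [hA, hq, Real.sqrt_mul (by norm_num), Real.sqrt_mul hm2R.le]
        have : 0 < √(m₂:ℝ) := Real.sqrt_pos.2 hm2R
        have : 0 < √Q := Real.sqrt_pos.2 hQpos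
        field_simp
      rw [e1]
      refine (ratio_close A A' μ F q L A0 b c e hA0' hF0 hsL hqpos.le ?_ (min_le_left _ _)
        hw2.le (min_le_left _ _) hAA').trans htot
      have : q ^ 2 - 1 = (m₂ * Q - t ^ 2) / t ^ 2 := by rw [hq2]; field_simp
      rw [this, abs_div, abs_of_pos (show 0 < t ^ 2 by positivity), div_le_iff₀ (by positivity)]
      exact hw1

end

section
lemma dot_eq_dotProduct {d : ℕ} (x y : Fin d → ℝ) : dot x y = x ⬝ᵥ y := rfl

lemma reduce_model {d : ℕ} (S : Matrix (Fin d) (Fin d) ℝ) (P : Measure (Fin d → ℝ))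
    (hP : IsGaussianVec P 0 S) (lo hi : ℝ) (hlo : 0 < lo)
    (heig : ∀ u : Fin d → ℝ, dot u u = 1 →
      lo ≤ dot u (S.mulVec u) ∧ dot u (S.mulVec u) ≤ hi) :
    ∃ s : Fin d → ℝ, (∀ k, lo ≤ s k) ∧ (∀ k, s k ≤ hi) ∧
      frobSq (S - 1) = ∑ k, (s k - 1) ^ 2 ∧ Matrix.trace (S * S) = ∑ k, s k ^ 2 ∧
      ∀ (m₁ m₂ : ℕ) (z : ℝ),
        (Measure.pi fun _ : Fin (m₁ + m₂) => P).real {ω | z < Tcov d m₁ m₂ ω} =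
        (Measure.pi fun _ : Fin (m₁ + m₂) => gam d).real
        {ω | z < studentized m₁ (fun i =>
          (∑ j : Fin m₂, Hs s (ω (Fin.castAdd m₂ i)) (ω (Fin.natAdd m₁ j))) / m₂)} := by
  obtain ⟨U, s, h1, h2, h3⟩ := spec S hP.2.1
  have hk : ∀ k, dot (U.col k) (U.col k) = 1 ∧ dot (U.col k) (S.mulVec (U.col k)) = s k := by
    intro k
    have a1 : U.transpose.mulVec (U.col k) = Pi.single k 1 := by
      have : U.col k = U.mulVec (Pi.single k 1) := by simp
      rw [this, Matrix.mulVec_mulVec, h2, Matrix.one_mulVec]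
    constructor
    · have : dot (U.col k) (U.col k) = (U.transpose * U) k k := by
        simp [dot, Matrix.mul_apply]
      rw [this, h2]; simp
    · rw [h3, ← Matrix.mulVec_mulVec, ← Matrix.mulVec_mulVec, dot_mulVec, a1]
      simp [dot, Matrix.mulVec_diagonal, Pi.single_apply]
  have hs : ∀ k, lo ≤ s k ∧ s k ≤ hi := by
    intro k
    have := heig (U.col k) (hk k).1
    rwa [(hk k).2] at this
  have hS1 : S - 1 = U * Matrix.diagonal (fun k => s k - 1) * U.transpose := by
    have : Matrix.diagonal (fun k => s k - 1) = Matrix.diagonal s - 1 := by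
      rw [← Matrix.diagonal_one, Matrix.diagonal_sub]
    rw [this, Matrix.mul_sub, Matrix.sub_mul, ← h3, Matrix.mul_one, h1]
  refine ⟨s, fun k => (hs k).1, fun k => (hs k).2, ?_, ?_, ?_⟩
  · rw [hS1, frobSq_spec U _ h2]
  · have := frobSq_eq_trace S
    rw [hP.2.1.eq] at this
    rw [← this]
    conv_lhs => rw [h3]
    rw [frobSq_spec U _ h2]
  · intro m₁ m₂ z
    set M := U * Matrix.diagonal (fun k => √(s k)) with hM
    have hs0 : ∀ k, 0 ≤ s k := fun k => hlo.le.trans (hs k).1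
    have hdd : Matrix.diagonal (fun k => √(s k)) * Matrix.diagonal (fun k => √(s k)) =
        Matrix.diagonal s := by
      rw [Matrix.diagonal_mul_diagonal]
      congr 1; ext k; exact Real.mul_self_sqrt (hs0 k)
    have hMM : S = M * M.transpose := by
      rw [hM, Matrix.transpose_mul, Matrix.diagonal_transpose, Matrix.mul_assoc U,
        ← Matrix.mul_assoc (Matrix.diagonal _), hdd, ← Matrix.mul_assoc]
      exact h3
    have hMtM : M.transpose * M = Matrix.diagonal s := by
      rw [hM, Matrix.transpose_mul, Matrix.diagonal_transpose, Matrix.mul_assoc,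
        ← Matrix.mul_assoc U.transpose, h2, Matrix.one_mul, hdd]
    have hdot : ∀ x y, dot (M.mulVec x) (M.mulVec y) = ∑ k, s k * x k * y k := by
      intro x y
      rw [dot_mulVec, Matrix.mulVec_mulVec, hMtM]
      simp [dot, Matrix.mulVec_diagonal]
    have hH : ∀ x y, hCov d (M.mulVec x) (M.mulVec y) = Hs s x y := by
      intro x y
      have h : ∀ v : Fin d → ℝ, ∑ k, s k * v k * v k = ∑ k, s k * v k ^ 2 := fun v =>
        Finset.sum_congr rfl fun k _ => by ring
      simp only [hCov, hdot, Hs, h]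
    have hPm := gauss_eq_map P S M hP hMM
    have hMmeas : Measurable (fun x : Fin d → ℝ => M.mulVec x) := measurable_mulVec M
    have hpi : (Measure.pi fun _ : Fin (m₁ + m₂) => P) =
        (Measure.pi fun _ : Fin (m₁ + m₂) => gam d).map (fun ω i => M.mulVec (ω i)) := by
      rw [hPm]
      have : IsProbabilityMeasure ((gam d).map fun x => M.mulVec x) :=
        Measure.isProbabilityMeasure_map hMmeas.aemeasurable
      exact (Measure.pi_map_pi (fun _ => hMmeas.aemeasurable)).symm
    have hT : MeasurableSet {ω : Fin (m₁ + m₂) → Fin d → ℝ | z < Tcov d m₁ m₂ ω} := by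
      refine measurableSet_lt measurable_const (measurable_studentized _ _ fun i => ?_)
      refine (Finset.measurable_sum _ fun j _ => ?_).div_const _
      unfold hCov dot
      fun_prop
    rw [hpi, map_measureReal_apply (by fun_prop) hT]
    congr 1
    ext ω
    simp only [Set.mem_preimage, Set.mem_ofPred_eq, Tcov, hH]

lemma sqrt_mul_one_sub_le (κ : ℝ) : √(κ * (1 - κ)) ≤ √((1 / 2) * (1 - 1 / 2)) :=
  Real.sqrt_le_sqrt (by nlinarith [sq_nonneg (κ - 1 / 2)])

end

set_option maxHeartbeats 2000000 in
theorem cross_cov_asymptotic_power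
    (α : ℝ) (hα : 0 < α ∧ α < 1)
    (d m₁ : ℕ → ℕ) (hm : ∀ n, m₁ n ≤ n)
    (S : ∀ n, Matrix (Fin (d n)) (Fin (d n)) ℝ)
    (P : ∀ n, Measure (Fin (d n) → ℝ))
    (hP : ∀ n, IsGaussianVec (P n) 0 (S n))
    (lamlo lamhi : ℝ) (hlo : 0 < lamlo)
    (heig : ∀ n, ∀ u : Fin (d n) → ℝ, dot u u = 1 →
      lamlo ≤ dot u ((S n).mulVec u) ∧ dot u ((S n).mulVec u) ≤ lamhi)
    (hloc : ∃ C : ℝ, ∀ n, Real.sqrt (frobSq (S n - 1)) ≤ C * Real.sqrt ((d n : ℝ) / n))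
    (τ : ℝ) (hτ : 0 < τ)
    (hd : Tendsto (fun n => (d n : ℝ) / n) atTop (nhds τ))
    (κ : ℝ) (hκ : 0 < κ ∧ κ < 1)
    (hm1 : Tendsto (fun n => (m₁ n : ℝ) / n) atTop (nhds κ))
    (z1a za : ℝ) (hz1 : Φ z1a = 1 - α) (hza : Φ za = α) :
    Tendsto (fun n =>
        ((Measure.pi fun _ : Fin (m₁ n + (n - m₁ n)) => P n)
            {ω | z1a < Tcov (d n) (m₁ n) (n - m₁ n) ω}).toReal -
          Φ (za + n * Real.sqrt (κ * (1 - κ)) * frobSq (S n - 1) /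
              (Real.sqrt 2 * Matrix.trace (S n * S n))))
      atTop (nhds 0) ∧
    ∀ κ' : ℝ, 0 < κ' → κ' < 1 →
      Real.sqrt (κ' * (1 - κ')) ≤ Real.sqrt ((1 / 2) * (1 - 1 / 2)) := by
  refine ⟨?_, fun κ' _ _ => sqrt_mul_one_sub_le κ'⟩
  obtain ⟨C, hC⟩ := hloc
  have hzz : za = -z1a := by
    apply Phi_strictMono.injective
    rw [Phi_neg, hz1, hza]; ring
  choose s hs1 hs2 hsF hst hsP using fun n =>
    reduce_model (S n) (P n) (hP n) lamlo lamhi hlo (heig n)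
  set L : ℝ := C ^ 2 * (τ + 1) with hL
  have hL0 : 0 ≤ L := by positivity
  set B : ℝ := 2 / (lamlo ^ 2 * τ) with hB
  have hB0 : 0 < B := by positivity
  set k : ℝ := √(κ * (1 - κ)) with hk
  have hk0 : 0 ≤ k := Real.sqrt_nonneg _
  have hk1 : k ≤ 1 := by
    refine Real.sqrt_le_one.2 ?_; nlinarith [sq_nonneg κ]
  rw [Metric.tendsto_nhds]
  intro ε hε
  obtain ⟨N, e, he, hpow⟩ := power_fin lamlo lamhi L (2 / τ) B z1a (B * L) (ε / 4) hlo hL0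
    (by positivity) hB0.le (by positivity)
  have hr : Tendsto (fun n : ℕ => √((m₁ n : ℝ) / n * (1 - (m₁ n : ℝ) / n))) atTop (nhds k) :=
    (hm1.mul (tendsto_const_nhds.sub hm1)).sqrt
  have hrc := (Metric.tendsto_nhds.1 hr) (e / B) (by positivity)
  have hn : Tendsto (fun n : ℕ => (n : ℝ)) atTop atTop := tendsto_natCast_atTop_atTop
  have hdlo := hd.eventually (lt_mem_nhds (show τ / 2 < τ by linarith))
  have hdhi := hd.eventually (gt_mem_nhds (show τ < τ + 1 by linarith))
  have hmlo := hm1.eventually (lt_mem_nhds (show κ / 2 < κ by linarith [hκ.1]))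
  have hmhi := hm1.eventually (gt_mem_nhds (show κ < (κ + 1) / 2 by linarith [hκ.2]))
  have hbig : ∀ a : ℝ, 0 < a → ∀ᶠ n : ℕ in atTop, (N : ℝ) ≤ a * n := fun a ha =>
    (hn.const_mul_atTop ha).eventually_ge_atTop _
  filter_upwards [hrc, hdlo, hdhi, hmlo, hmhi, hbig (τ / 2) (by positivity),
    hbig (κ / 2) (by linarith [hκ.1]), hbig ((1 - κ) / 2) (by linarith [hκ.2]),
    eventually_ge_atTop 1] with n a1 a2 a3 a4 a5 a6 a7 a8 a9
  have hnR : (0:ℝ) < n := by exact_mod_cast a9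
  rw [lt_div_iff₀ hnR] at a2 a4
  have a3' := a3
  rw [div_lt_iff₀ hnR] at a3' a5
  have hm2 : ((n - m₁ n : ℕ) : ℝ) = n - m₁ n := by rw [Nat.cast_sub (hm n)]
  have hNd : N ≤ d n := by
    have : (N : ℝ) ≤ d n := by linarith
    exact_mod_cast this
  have hN1 : N ≤ m₁ n := by
    have : (N : ℝ) ≤ m₁ n := by linarith
    exact_mod_cast this
  have hN2 : N ≤ n - m₁ n := by
    have : (N : ℝ) ≤ ((n - m₁ n : ℕ) : ℝ) := by rw [hm2]; linarith
    exact_mod_cast this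
  have hm1n : (m₁ n : ℝ) ≤ n := by exact_mod_cast hm n
  have hm10 : (0:ℝ) ≤ m₁ n := Nat.cast_nonneg _
  have hmd : ((n - m₁ n : ℕ) : ℝ) ≤ 2 / τ * d n := by
    rw [hm2, div_mul_eq_mul_div, le_div_iff₀ hτ]
    nlinarith
  have hF0 : 0 ≤ ∑ i, (s n i - 1) ^ 2 := Finset.sum_nonneg fun i _ => sq_nonneg _
  have hFL : ∑ i, (s n i - 1) ^ 2 ≤ L := by
    have h := hC n
    rw [hsF n] at h
    have h' := pow_le_pow_left₀ (Real.sqrt_nonneg _) h 2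
    rw [Real.sq_sqrt hF0, mul_pow, Real.sq_sqrt (by positivity)] at h'
    refine h'.trans ?_
    rw [hL]; gcongr
  have ht : lamlo ^ 2 * (d n : ℝ) ≤ ∑ i, s n i ^ 2 := by
    calc lamlo ^ 2 * (d n : ℝ) = ∑ _i : Fin (d n), lamlo ^ 2 := by simp [mul_comm]
      _ ≤ _ := Finset.sum_le_sum fun i _ => pow_le_pow_left₀ hlo.le (hs1 n i) 2
  have key := hpow (d n) (m₁ n) (n - m₁ n) hNd hN1 hN2 hmd (s n) (hs1 n) (hs2 n) hFL
  rw [← hsP n] at key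
  rw [hsF n, hst n]
  set t := ∑ i, s n i ^ 2 with htdef
  set F := ∑ i, (s n i - 1) ^ 2 with hFdef
  have htn : lamlo ^ 2 * τ / 2 * n ≤ t := by
    refine le_trans ?_ ht
    have : 0 < lamlo ^ 2 := by positivity
    nlinarith
  have htpos : 0 < t := lt_of_lt_of_le (by positivity) htn
  have h2 : 1 ≤ √(2:ℝ) := by rw [Real.one_le_sqrt]; norm_num
  set g : ℝ := n / (√2 * t) with hg
  have hg0 : 0 ≤ g := by positivity
  have hgB : g ≤ B := by
    rw [hg, hB, div_le_div_iff₀ (by positivity) (by positivity)]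
    nlinarith
  set r : ℝ := √((m₁ n : ℝ) / n * (1 - (m₁ n : ℝ) / n)) with hrdef
  have hr0 : 0 ≤ r := Real.sqrt_nonneg _
  have hx1 : (m₁ n : ℝ) / n ≤ 1 := by rw [div_le_one hnR]; exact hm1n
  have hx0 : 0 ≤ (m₁ n : ℝ) / n := by positivity
  have hr1 : r ≤ 1 := by
    refine Real.sqrt_le_one.2 ?_
    nlinarith
  have hA : g * r = √(m₁ n : ℝ) * √((n - m₁ n : ℕ) : ℝ) / (√2 * t) := by
    rw [← Real.sqrt_mul hm10, hm2]
    have : (m₁ n : ℝ) * (n - m₁ n) = (n:ℝ) ^ 2 * ((m₁ n : ℝ) / n * (1 - (m₁ n : ℝ) / n)) := by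
      field_simp
    rw [this, Real.sqrt_mul (by positivity), Real.sqrt_sq hnR.le, hg, ← hrdef]
    ring
  have key2 := key (g * r) (g * k) hA
    (by rw [abs_of_nonneg (by positivity)]; nlinarith)
    (by
      rw [← mul_sub, abs_mul, abs_of_nonneg hg0]
      rw [Real.dist_eq, lt_div_iff₀ hB0] at a1
      nlinarith [abs_nonneg (r - k)])
    (by
      rw [abs_of_nonneg (by positivity)]
      have : g * k ≤ B := by nlinarith
      exact mul_le_mul this hFL hF0 hB0.le)
  have harg : za + n * k * F / (√2 * t) = g * k * F - z1a := by
    rw [hzz, hg]; ring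
  rw [harg, Real.dist_eq, sub_zero]
  refine lt_of_le_of_lt key2 (by linarith)

end
end

section
/- Let X_1,…,X_n be i.i.d. random vectors in ℝ^d with mean μ and covariance matrix Σ with finite second moments, n = m_1 + m_2, and let μ̂_1 = m_1^{-1}∑_{i=1}^{m_1} X_i and μ̂_2 = m_2^{-1}∑_{j=m_1+1}^n X_j. Then E[ μ̂_2ᵀμ̂_1 ] = ‖μ‖_2² and Var[ μ̂_2ᵀμ̂_1 ] = (1/m_1 + 1/m_2) μᵀΣμ + tr(Σ²)/(m_1 m_2). -/
/-!
Statement 16: Mean and variance of the cross statistic `μ̂₂ᵀμ̂₁` under the alternative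
(conditions (C1)–(C2) in the proof of Theorem 3 of Kim & Ramdas).  For i.i.d. random
vectors with mean `μ` and covariance `Σ` with finite second moments:
`E[μ̂₂ᵀμ̂₁] = ‖μ‖₂²` and `Var[μ̂₂ᵀμ̂₁] = (1/m₁ + 1/m₂)·μᵀΣμ + tr(Σ²)/(m₁m₂)`.
-/

open MeasureTheory ProbabilityTheory Filter

noncomputable section

/-- The unstudentized cross statistic `μ̂₁ᵀμ̂₂`. -/
def TmeanDagger (d m₁ m₂ : ℕ) (ω : Fin (m₁ + m₂) → Fin d → ℝ) : ℝ :=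
  dot (fun j => (∑ i : Fin m₁, ω (Fin.castAdd m₂ i) j) / m₁)
      (fun j => (∑ i : Fin m₂, ω (Fin.natAdd m₁ i) j) / m₂)

/-- Block sample mean, coordinate `j`. -/
def blockMean {d n m : ℕ} (e : Fin m → Fin n) (j : Fin d) (ω : Fin n → Fin d → ℝ) : ℝ :=
  (∑ i : Fin m, ω (e i) j) / m

section Aux

variable {d n m : ℕ} {P : Measure (Fin d → ℝ)} [IsProbabilityMeasure P]

lemma aux_memLp (hint : ∀ i j, Integrable (fun x : Fin d → ℝ => x i * x j) P) (j : Fin d) :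
    MemLp (fun x : Fin d → ℝ => x j) 2 P := by
  rw [memLp_two_iff_integrable_sq (measurable_pi_apply j).aestronglyMeasurable]
  simpa [sq] using hint j j

lemma aux_memLp_eval (hint : ∀ i j, Integrable (fun x : Fin d → ℝ => x i * x j) P)
    (a : Fin n) (j : Fin d) :
    MemLp (fun ω : Fin n → Fin d → ℝ => ω a j) 2 (Measure.pi fun _ => P) :=
  (aux_memLp hint j).comp_measurePreserving (measurePreserving_eval (fun _ => P) a)

lemma aux_integral_eval (a : Fin n) (f : (Fin d → ℝ) → ℝ) (hf : Measurable f) :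
    ∫ ω : Fin n → Fin d → ℝ, f (ω a) ∂(Measure.pi fun _ => P) = ∫ x, f x ∂P := by
  have h := (measurePreserving_eval (fun _ : Fin n => P) a).map_eq
  conv_rhs => rw [← h]
  rw [integral_map (measurable_pi_apply a).aemeasurable hf.aestronglyMeasurable]
  try rfl

lemma aux_iIndep : iIndepFun (fun (a : Fin n) (ω : Fin n → Fin d → ℝ) => ω a)
    (Measure.pi fun _ => P) :=
  iIndepFun_pi (X := fun _ => id) (fun _ => aemeasurable_id)

lemma aux_second (hint : ∀ i j, Integrable (fun x : Fin d → ℝ => x i * x j) P)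
    {μv : Fin d → ℝ} (hmean : ∀ i, ∫ x, x i ∂P = μv i) {S : Matrix (Fin d) (Fin d) ℝ}
    (hS : ∀ i j, ∫ x, (x i - μv i) * (x j - μv j) ∂P = S i j) (i j : Fin d) :
    ∫ x, x i * x j ∂P = μv i * μv j + S i j := by
  have hi : ∀ i, Integrable (fun x : Fin d → ℝ => x i) P :=
    fun i => (aux_memLp hint i).integrable one_le_two
  have h : ∀ x : Fin d → ℝ, (x i - μv i) * (x j - μv j)
      = (x i * x j - x i * μv j) - (μv i * x j - μv i * μv j) := fun x => by ring
  rw [← hS i j]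
  simp_rw [h]
  have k1 : Integrable (fun x : Fin d → ℝ => x i * x j - x i * μv j) P :=
    (hint i j).sub ((hi i).mul_const _)
  have k2 : Integrable (fun x : Fin d → ℝ => μv i * x j - μv i * μv j) P :=
    ((hi j).const_mul _).sub (integrable_const _)
  rw [integral_sub k1 k2,
    integral_sub (hint i j) ((hi i).mul_const _),
    integral_sub ((hi j).const_mul _) (integrable_const _),
    integral_mul_const, integral_const_mul, hmean, hmean]
  simp

lemma aux_cross (hint : ∀ i j, Integrable (fun x : Fin d → ℝ => x i * x j) P)
    {μv : Fin d → ℝ} (hmean : ∀ i, ∫ x, x i ∂P = μv i) {S : Matrix (Fin d) (Fin d) ℝ}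
    (hS : ∀ i j, ∫ x, (x i - μv i) * (x j - μv j) ∂P = S i j) (a b : Fin n) (j k : Fin d) :
    ∫ ω : Fin n → Fin d → ℝ, ω a j * ω b k ∂(Measure.pi fun _ => P)
      = μv j * μv k + if a = b then S j k else 0 := by
  split_ifs with hab
  · subst hab
    rw [aux_integral_eval a (fun x => x j * x k) (by fun_prop), aux_second hint hmean hS]
  · have h := (aux_iIndep (n := n) (P := P)).indepFun hab
    have h2 : IndepFun (fun ω : Fin n → Fin d → ℝ => ω a j) (fun ω => ω b k)
        (Measure.pi fun _ => P) :=
      h.comp (measurable_pi_apply j) (measurable_pi_apply k)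
    rw [h2.integral_fun_mul_eq_mul_integral (aux_memLp_eval hint a j).aestronglyMeasurable
      (aux_memLp_eval hint b k).aestronglyMeasurable,
      aux_integral_eval a (fun x => x j) (by fun_prop),
      aux_integral_eval b (fun x => x k) (by fun_prop), hmean, hmean, add_zero]

lemma blockMean_memLp (hint : ∀ i j, Integrable (fun x : Fin d → ℝ => x i * x j) P)
    (e : Fin m → Fin n) (j : Fin d) :
    MemLp (blockMean e j) 2 (Measure.pi fun _ => P) := by
  have h : MemLp (fun ω : Fin n → Fin d → ℝ => ∑ i : Fin m, ω (e i) j) 2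
      (Measure.pi fun _ => P) := memLp_finsetSum _ (fun i _ => aux_memLp_eval hint (e i) j)
  have h2 := h.mul_const ((m : ℝ)⁻¹)
  simp only [← div_eq_mul_inv] at h2
  exact h2

lemma blockMean_integral (hint : ∀ i j, Integrable (fun x : Fin d → ℝ => x i * x j) P)
    {μv : Fin d → ℝ} (hmean : ∀ i, ∫ x, x i ∂P = μv i)
    (hm : 0 < m) (e : Fin m → Fin n) (j : Fin d) :
    ∫ ω, blockMean e j ω ∂(Measure.pi fun _ => P) = μv j := by
  have hm' : (m : ℝ) ≠ 0 := by positivity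
  unfold blockMean
  rw [integral_div, integral_finsetSum _
    (fun i _ => (aux_memLp_eval hint (e i) j).integrable one_le_two)]
  simp_rw [fun a : Fin n => aux_integral_eval (P := P) a (fun x => x j) (by fun_prop), hmean]
  simp
  field_simp

lemma blockMean_integral_mul (hint : ∀ i j, Integrable (fun x : Fin d → ℝ => x i * x j) P)
    {μv : Fin d → ℝ} (hmean : ∀ i, ∫ x, x i ∂P = μv i) {S : Matrix (Fin d) (Fin d) ℝ}
    (hS : ∀ i j, ∫ x, (x i - μv i) * (x j - μv j) ∂P = S i j)
    (hm : 0 < m) (e : Fin m → Fin n) (he : Function.Injective e) (j k : Fin d) :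
    ∫ ω, blockMean e j ω * blockMean e k ω ∂(Measure.pi fun _ => P)
      = μv j * μv k + S j k / m := by
  have hm' : (m : ℝ) ≠ 0 := by positivity
  have h : ∀ ω : Fin n → Fin d → ℝ, blockMean e j ω * blockMean e k ω
      = (∑ i : Fin m, ∑ i' : Fin m, ω (e i) j * ω (e i') k) / ((m : ℝ) * m) := by
    intro ω
    unfold blockMean
    rw [div_mul_div_comm, Finset.sum_mul_sum]
  simp_rw [h]
  have hI : ∀ a b : Fin n, Integrable (fun ω : Fin n → Fin d → ℝ => ω a j * ω b k)
      (Measure.pi fun _ => P) :=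
    fun a b => (aux_memLp_eval hint a j).integrable_mul (aux_memLp_eval hint b k)
  rw [integral_div, integral_finsetSum _
    (fun i _ => integrable_finsetSum _ (fun i' _ => hI _ _))]
  simp_rw [fun i : Fin m => integral_finsetSum (μ := Measure.pi fun _ : Fin n => P)
    Finset.univ (fun (i' : Fin m) _ => hI (e i) (e i')), aux_cross hint hmean hS, he.eq_iff]
  simp [Finset.sum_add_distrib]
  field_simp

lemma block_indep {m₁ m₂ : ℕ} :
    IndepFun (fun (ω : Fin (m₁ + m₂) → Fin d → ℝ) (i : Fin m₁) => ω (Fin.castAdd m₂ i))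
      (fun ω (i : Fin m₂) => ω (Fin.natAdd m₁ i)) (Measure.pi fun _ => P) := by
  classical
  have h := (aux_iIndep (n := m₁ + m₂) (P := P)).indepFun_finset
    (Finset.univ.image (Fin.castAdd m₂)) (Finset.univ.image (Fin.natAdd m₁))
    (by
      rw [Finset.disjoint_left]
      intro a ha hb
      simp only [Finset.mem_image, Finset.mem_univ, true_and] at ha hb
      obtain ⟨i, rfl⟩ := ha
      obtain ⟨i', hi'⟩ := hb
      have := congrArg Fin.val hi'
      simp at this
      omega)
    (fun i => measurable_pi_apply i)
  have hφ : Measurable (fun (x : (Finset.univ.image (Fin.castAdd (n := m₁) m₂) :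
      Finset (Fin (m₁ + m₂))) → Fin d → ℝ) (i : Fin m₁) =>
        x ⟨Fin.castAdd m₂ i, Finset.mem_image_of_mem _ (Finset.mem_univ i)⟩) :=
    measurable_pi_lambda _ fun i => measurable_pi_apply _
  have hψ : Measurable (fun (x : (Finset.univ.image (Fin.natAdd (m := m₂) m₁) :
      Finset (Fin (m₁ + m₂))) → Fin d → ℝ) (i : Fin m₂) =>
        x ⟨Fin.natAdd m₁ i, Finset.mem_image_of_mem _ (Finset.mem_univ i)⟩) :=
    measurable_pi_lambda _ fun i => measurable_pi_apply _
  exact h.comp hφ hψ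

lemma aux_meas (j : Fin d) :
    Measurable (fun x : Fin m → Fin d → ℝ => (∑ i, x i j) / (m : ℝ)) := by
  fun_prop

lemma blockMean_indep {m₁ m₂ : ℕ} (j : Fin d) :
    IndepFun (blockMean (Fin.castAdd (n := m₁) m₂) j) (blockMean (Fin.natAdd (m := m₂) m₁) j)
      (Measure.pi fun _ => P) :=
  (block_indep (P := P) (m₁ := m₁) (m₂ := m₂)).comp (aux_meas j) (aux_meas j)

lemma blockMean_indep_mul {m₁ m₂ : ℕ} (j k : Fin d) :
    IndepFun (fun ω => blockMean (Fin.castAdd (n := m₁) m₂) j ω *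
        blockMean (Fin.castAdd (n := m₁) m₂) k ω)
      (fun ω => blockMean (Fin.natAdd (m := m₂) m₁) j ω *
        blockMean (Fin.natAdd (m := m₂) m₁) k ω)
      (Measure.pi fun _ => P) :=
  (block_indep (P := P) (m₁ := m₁) (m₂ := m₂)).comp ((aux_meas j).mul (aux_meas k))
    ((aux_meas j).mul (aux_meas k))

end Aux

theorem cross_mean_dagger_moments
    (d m₁ m₂ : ℕ) (hm₁ : 0 < m₁) (hm₂ : 0 < m₂)
    (P : Measure (Fin d → ℝ)) (hP : IsProbabilityMeasure P)
    (μv : Fin d → ℝ) (hmean : ∀ i, ∫ x, x i ∂P = μv i)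
    (hint : ∀ i j, Integrable (fun x => x i * x j) P)
    (S : Matrix (Fin d) (Fin d) ℝ)
    (hS : ∀ i j, ∫ x, (x i - μv i) * (x j - μv j) ∂P = S i j) :
    (∫ ω, TmeanDagger d m₁ m₂ ω ∂(Measure.pi fun _ : Fin (m₁ + m₂) => P)
        = dot μv μv) ∧
    variance (TmeanDagger d m₁ m₂) (Measure.pi fun _ : Fin (m₁ + m₂) => P)
        = (1 / (m₁ : ℝ) + 1 / (m₂ : ℝ)) * dot μv (S.mulVec μv) +
            Matrix.trace (S * S) / ((m₁ : ℝ) * (m₂ : ℝ)) := by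
  have hm1 : (m₁ : ℝ) ≠ 0 := by positivity
  have hm2 : (m₂ : ℝ) ≠ 0 := by positivity
  set Q : Measure (Fin (m₁ + m₂) → Fin d → ℝ) := Measure.pi fun _ => P with hQ
  set A : Fin d → (Fin (m₁ + m₂) → Fin d → ℝ) → ℝ := blockMean (Fin.castAdd m₂) with hA
  set B : Fin d → (Fin (m₁ + m₂) → Fin d → ℝ) → ℝ := blockMean (Fin.natAdd m₁) with hB
  have hT : TmeanDagger d m₁ m₂ = fun ω => ∑ j, A j ω * B j ω := rfl
  have hA2 : ∀ j, MemLp (A j) 2 Q := fun j => blockMean_memLp hint _ j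
  have hB2 : ∀ j, MemLp (B j) 2 Q := fun j => blockMean_memLp hint _ j
  have hAB : ∀ j, IndepFun (A j) (B j) Q := fun j => blockMean_indep j
  have hABm : ∀ j k, IndepFun (fun ω => A j ω * A k ω) (fun ω => B j ω * B k ω) Q :=
    fun j k => blockMean_indep_mul j k
  have hAi : ∀ j k, Integrable (fun ω => A j ω * A k ω) Q :=
    fun j k => (hA2 j).integrable_mul (hA2 k)
  have hBi : ∀ j k, Integrable (fun ω => B j ω * B k ω) Q :=
    fun j k => (hB2 j).integrable_mul (hB2 k)
  have hre : ∀ j k, (fun ω => (A j ω * B j ω) * (A k ω * B k ω))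
      = fun ω => (A j ω * A k ω) * (B j ω * B k ω) := by
    intro j k; funext ω; ring
  have hprod : ∀ j k, Integrable (fun ω => (A j ω * B j ω) * (A k ω * B k ω)) Q := by
    intro j k
    rw [hre]
    exact (hABm j k).integrable_mul (hAi j k) (hBi j k)
  have hABi : ∀ j, Integrable (fun ω => A j ω * B j ω) Q :=
    fun j => (hA2 j).integrable_mul (hB2 j)
  have hAB2 : ∀ j, MemLp (fun ω => A j ω * B j ω) 2 Q := by
    intro j
    rw [memLp_two_iff_integrable_sq (hABi j).aestronglyMeasurable]
    simpa only [sq] using hprod j j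
  have hT2 : MemLp (TmeanDagger d m₁ m₂) 2 Q := by
    rw [hT]
    exact memLp_finsetSum _ (fun j _ => hAB2 j)
  have hE : ∫ ω, TmeanDagger d m₁ m₂ ω ∂Q = dot μv μv := by
    rw [hT, integral_finsetSum _ (fun j _ => hABi j), dot]
    refine Finset.sum_congr rfl fun j _ => ?_
    rw [(hAB j).integral_fun_mul_eq_mul_integral (hA2 j).aestronglyMeasurable
      (hB2 j).aestronglyMeasurable, hA, hB, hQ, blockMean_integral hint hmean hm₁,
      blockMean_integral hint hmean hm₂]
  refine ⟨hE, ?_⟩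
  have hsym : ∀ j k, S j k = S k j := by
    intro j k
    rw [← hS j k, ← hS k j]
    simp_rw [mul_comm]
  have hE2 : ∫ ω, (TmeanDagger d m₁ m₂ ^ 2) ω ∂Q
      = ∑ j, ∑ k, (μv j * μv k + S j k / m₁) * (μv j * μv k + S j k / m₂) := by
    have h : (TmeanDagger d m₁ m₂ ^ 2)
        = fun ω => ∑ j, ∑ k, (A j ω * B j ω) * (A k ω * B k ω) := by
      funext ω
      rw [hT, Pi.pow_apply, sq, Finset.sum_mul_sum]
    rw [h, integral_finsetSum _ (fun j _ => integrable_finsetSum _ (fun k _ => hprod j k))]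
    refine Finset.sum_congr rfl fun j _ => ?_
    rw [integral_finsetSum _ (fun k _ => hprod j k)]
    refine Finset.sum_congr rfl fun k _ => ?_
    rw [hre, (hABm j k).integral_fun_mul_eq_mul_integral (hAi j k).aestronglyMeasurable
      (hBi j k).aestronglyMeasurable, hA, hB, hQ,
      blockMean_integral_mul hint hmean hS hm₁ _ (Fin.castAdd_injective _ _),
      blockMean_integral_mul hint hmean hS hm₂ _ (Fin.natAdd_injective _ _)]
  rw [variance_eq_sub hT2, hE2, hE]
  have h1 : dot μv μv ^ 2 = ∑ j, ∑ k, (μv j * μv j) * (μv k * μv k) := by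
    rw [dot, sq, Finset.sum_mul_sum]
  have h2 : dot μv (S.mulVec μv) = ∑ j, ∑ k, μv j * (S j k * μv k) := by
    simp only [dot, Matrix.mulVec, dotProduct, Finset.mul_sum]
  have h3 : Matrix.trace (S * S) = ∑ j, ∑ k, S j k * S j k := by
    simp only [Matrix.trace, Matrix.diag, Matrix.mul_apply]
    refine Finset.sum_congr rfl fun j _ => Finset.sum_congr rfl fun k _ => ?_
    rw [hsym k j]
  rw [h1, h2, h3]
  simp only [Finset.mul_sum, Finset.sum_div, ← Finset.sum_sub_distrib, ← Finset.sum_add_distrib]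
  refine Finset.sum_congr rfl fun j _ => Finset.sum_congr rfl fun k _ => ?_
  field_simp
  ring

end
end
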